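/- Let ψ : qA → B be a *-homomorphism of C*-algebras. The following are equivalent: (i) the linear map A ∋ x ↦ ψ(qx) ∈ B is nuclear; (ii) for every y ∈ qA the linear maps A → B given by x ↦ ψ(ι(x)y) and x ↦ ψ(ῑ(x)y) are nuclear; (iii) ψ is represented by a prequasihomomorphism (ψ₁, ψ₂) : A ⇉ E ⊳ J ↪ B in which both ψ₁ and ψ₂ are weakly nuclear relative to J; (iv) letting ψ° : QA → M(h(ψ(qA))) be the canonical extension of ψ into the multipliers of the hereditary subalgebra h(ψ(qA)) of B generated by ψ(qA), both ψ° ∘ ι and ψ° ∘ ῑ are weakly nuclear relative to h(ψ(qA)). A homomorphism satisfying these conditions is called q-nuclear. -/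

import Mathlib

/-!
Statement 15 (Proposition 5.4 / `pnuc`): for a *-homomorphism `ψ : qA → B` the
following are equivalent:
(i)   `x ↦ ψ(qx)` is nuclear;
(ii)  for every `y ∈ qA` the maps `x ↦ ψ(ι(x)y)` and `x ↦ ψ(ῑ(x)y)` are nuclear;
(iii) `ψ` is represented by a prequasihomomorphism `(ψ₁, ψ₂) : A ⇉ E ⊳ J ↪ B`
      with `ψ₁, ψ₂` weakly nuclear relative to `J`;
(iv)  the canonical extension `ψ° : QA → 𝓜(H)`, `H` the hereditary subalgebra of
      `B` generated by `ψ(qA)`, has `ψ° ∘ ι` and `ψ° ∘ ῑ` weakly nuclear.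
Such a `ψ` is called `q`-nuclear.

Here `QA = A ⋆ A` with inclusions `ι, ῑ`, `qA = ker (QA → A)` (presented via an
embedding `j`), `qx = ι x - ῑ x` (via `qe`).  Nuclearity of linear maps is encoded
via C*-(semi)norms on algebraic tensor products, as in Statements 11–14.
-/

noncomputable section
open scoped TensorProduct

/-- The canonical star operation on an algebraic tensor product of C*-algebras:
an additive map `s` with `s (a ⊗ d) = a* ⊗ d*`.  (Such a map exists and is unique.) -/
def IsTensorStar {A D : Type} [NonUnitalCStarAlgebra A] [NonUnitalCStarAlgebra D]
    (s : TensorProduct ℂ A D →+ TensorProduct ℂ A D) : Prop :=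
  ∀ (a : A) (d : D), s (a ⊗ₜ[ℂ] d) = star a ⊗ₜ[ℂ] star d

/-- The star operation on an iterated algebraic tensor product `T ⊗ E`
relative to a star operation `s₂` on `T`. -/
def IsTensorStarRel {T E : Type} [AddCommMonoid T] [Module ℂ T] [NonUnitalCStarAlgebra E]
    (s₂ : T →+ T) (s₃ : TensorProduct ℂ T E →+ TensorProduct ℂ T E) : Prop :=
  ∀ (x : T) (e : E), s₃ (x ⊗ₜ[ℂ] e) = s₂ x ⊗ₜ[ℂ] star e

/-- `γ` is a C*-seminorm on the (non-unital) *-algebra `T`, with star operation `s`. -/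
structure IsCStarSeminorm {T : Type} [NonUnitalSemiring T] [Module ℂ T]
    (s : T →+ T) (γ : T → ℝ) : Prop where
  nonneg : ∀ x, 0 ≤ γ x
  add_le : ∀ x y, γ (x + y) ≤ γ x + γ y
  smul : ∀ (c : ℂ) (x), γ (c • x) = ‖c‖ * γ x
  mul_le : ∀ x y, γ (x * y) ≤ γ x * γ y
  cstar : ∀ x, γ (s x * x) = γ x ^ 2

/-- `γ` is a C*-norm on the (non-unital) *-algebra `T`, with star operation `s`. -/
structure IsCStarNorm {T : Type} [NonUnitalSemiring T] [Module ℂ T]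
    (s : T →+ T) (γ : T → ℝ) extends IsCStarSeminorm s γ : Prop where
  definite : ∀ x, γ x = 0 → x = 0

/-- `ρ ⊗ id_D : A ⊗_alg D → B ⊗_max D` is bounded by `K` for every C*-algebra `D`,
where `A ⊗_alg D` carries the minimal C*-norm.  This is encoded by quantifying over
all C*-norms `γ` on `A ⊗_alg D` (the minimal norm is the least such) and all
C*-seminorms `δ` on `B ⊗_alg D` (the maximal norm is the greatest such). -/
def NuclearBound {A B : Type} [NonUnitalCStarAlgebra A] [NonUnitalCStarAlgebra B]
    (ρ : A →ₗ[ℂ] B) (K : ℝ) : Prop :=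
  ∀ (D : Type) [NonUnitalCStarAlgebra D],
    ∀ (sA : TensorProduct ℂ A D →+ TensorProduct ℂ A D)
      (sB : TensorProduct ℂ B D →+ TensorProduct ℂ B D)
      (γ : TensorProduct ℂ A D → ℝ) (δ : TensorProduct ℂ B D → ℝ),
      IsTensorStar sA → IsTensorStar sB → IsCStarNorm sA γ → IsCStarSeminorm sB δ →
      ∀ x, δ (TensorProduct.map ρ (LinearMap.id : D →ₗ[ℂ] D) x) ≤ K * γ x

/-- A linear map `ρ : A → B` between C*-algebras is nuclear if
`ρ ⊗ id : A ⊗_min D → B ⊗_max D` is bounded by some `K ≥ 0`, for all `D`. -/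
def IsNuclearMap {A B : Type} [NonUnitalCStarAlgebra A] [NonUnitalCStarAlgebra B]
    (ρ : A →ₗ[ℂ] B) : Prop :=
  ∃ K : ℝ, 0 ≤ K ∧ NuclearBound ρ K

/-- The nuclear norm `‖ρ‖_nuc` of a linear map between C*-algebras. -/
def nucNorm {A B : Type} [NonUnitalCStarAlgebra A] [NonUnitalCStarAlgebra B]
    (ρ : A →ₗ[ℂ] B) : ℝ :=
  sInf {K : ℝ | 0 ≤ K ∧ NuclearBound ρ K}

/-- `j : B → E` realizes `B` as a closed two-sided ideal of `E`. -/
structure IsIdealEmbedding {B E : Type} [NonUnitalCStarAlgebra B] [NonUnitalCStarAlgebra E]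
    (j : B →⋆ₙₐ[ℂ] E) : Prop where
  inj : Function.Injective j
  closed : IsClosed (Set.range j)
  mul_mem_left : ∀ (e : E) (b : B), ∃ b', j b' = e * j b
  mul_mem_right : ∀ (e : E) (b : B), ∃ b', j b' = j b * e

/-- A presentation of the free product `Q = A ⋆ A` in the category of C*-algebras. -/
structure QPresentation (A Q : Type) [NonUnitalCStarAlgebra A] [NonUnitalCStarAlgebra Q] where
  ι : A →⋆ₙₐ[ℂ] Q
  ιbar : A →⋆ₙₐ[ℂ] Q
  free : ∀ (E : Type) [NonUnitalCStarAlgebra E] (f g : A →⋆ₙₐ[ℂ] E),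
    ∃! h : Q →⋆ₙₐ[ℂ] E, h.comp ι = f ∧ h.comp ιbar = g

/-- A witness that `ψ : qA → B` is represented by a prequasihomomorphism
`(ψ₁, ψ₂) : A ⇉ E ⊳ J ↪ B` whose components are weakly nuclear relative to `J`. -/
structure QNuclearWitness (A QA qA B : Type)
    [NonUnitalCStarAlgebra A] [NonUnitalCStarAlgebra QA] [NonUnitalCStarAlgebra qA]
    [NonUnitalCStarAlgebra B]
    (P : QPresentation A QA) (j : qA →⋆ₙₐ[ℂ] QA) (ψ : qA →⋆ₙₐ[ℂ] B)
    (E J : Type) [NonUnitalCStarAlgebra E] [NonUnitalCStarAlgebra J] : Type where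
  ψ₁ : A →⋆ₙₐ[ℂ] E
  ψ₂ : A →⋆ₙₐ[ℂ] E
  jJE : J →⋆ₙₐ[ℂ] E
  hJE : IsIdealEmbedding jJE
  jJB : J →⋆ₙₐ[ℂ] B
  hJB : Function.Injective jJB
  hdiff : ∀ x : A, ∃ u : J, jJE u = ψ₁ x - ψ₂ x
  Θ : QA →⋆ₙₐ[ℂ] E
  hΘ : Θ.comp P.ι = ψ₁
  hΘ' : Θ.comp P.ιbar = ψ₂
  hrep : ∀ z : qA, ∃ u : J, jJE u = Θ (j z) ∧ ψ z = jJB u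
  wn₁ : ∀ (u : J) (ρ : A →ₗ[ℂ] J), (∀ x, jJE (ρ x) = ψ₁ x * jJE u) → IsNuclearMap ρ
  wn₂ : ∀ (u : J) (ρ : A →ₗ[ℂ] J), (∀ x, jJE (ρ x) = ψ₂ x * jJE u) → IsNuclearMap ρ

set_option linter.all false
set_option linter.style.haveILetI false
set_option linter.unusedSectionVars false
structure CSN {T : Type*} [NonUnitalRing T] [StarRing T] [Module ℂ T] (γ : T → ℝ) : Prop where
  nonneg : ∀ x, 0 ≤ γ x
  add_le : ∀ x y, γ (x + y) ≤ γ x + γ y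
  smul_le : ∀ (c : ℂ) (x), γ (c • x) ≤ ‖c‖ * γ x
  mul_le : ∀ x y, γ (x * y) ≤ γ x * γ y
  cstar_le : ∀ x, γ x ^ 2 ≤ γ (star x * x)

namespace CSN
variable {T : Type*} [NonUnitalRing T] [StarRing T] [Module ℂ T] {γ : T → ℝ}

lemma zero (h : CSN γ) : γ 0 = 0 := by
  have := h.smul_le 0 0
  simp at this
  exact le_antisymm this (h.nonneg 0)

lemma smul (h : CSN γ) (c : ℂ) (x : T) : γ (c • x) = ‖c‖ * γ x := by
  refine le_antisymm (h.smul_le c x) ?_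
  rcases eq_or_ne c 0 with rfl | hc
  · simpa using h.nonneg _
  · have := h.smul_le c⁻¹ (c • x)
    rw [smul_smul, inv_mul_cancel₀ hc, one_smul, norm_inv] at this
    have hc' : 0 < ‖c‖ := norm_pos_iff.2 hc
    calc ‖c‖ * γ x ≤ ‖c‖ * (‖c‖⁻¹ * γ (c • x)) := by gcongr
      _ = _ := by field_simp

lemma neg (h : CSN γ) (x : T) : γ (-x) = γ x := by
  have := h.smul (-1) x
  simpa using this

lemma star_le (h : CSN γ) (x : T) : γ x ≤ γ (star x) := by
  have h1 := (h.cstar_le x).trans (h.mul_le _ _)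
  rcases (h.nonneg x).eq_or_lt with h0 | h0
  · rw [← h0]; exact h.nonneg _
  · nlinarith

lemma star_eq (h : CSN γ) (x : T) : γ (star x) = γ x :=
  le_antisymm (by simpa using h.star_le (star x)) (h.star_le x)

lemma cstar (h : CSN γ) (x : T) : γ (star x * x) = γ x ^ 2 := by
  refine le_antisymm ((h.mul_le _ _).trans ?_) (h.cstar_le x)
  rw [h.star_eq, sq]

lemma sum_le (h : CSN γ) {ι : Type*} (s : Finset ι) (f : ι → T) :
    γ (∑ i ∈ s, f i) ≤ ∑ i ∈ s, γ (f i) :=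
  Finset.le_sum_of_subadditive γ h.zero.le h.add_le s f

lemma sub_le (h : CSN γ) (x y : T) : γ (x - y) ≤ γ x + γ y := by
  rw [sub_eq_add_neg, ← h.neg y]; exact h.add_le _ _

end CSN

/-- Bounded action from unitary invariance. -/
lemma unitary_bound {M V : Type*} [CStarAlgebra M] [AddCommGroup V] [Module ℂ V]
    (X : Submodule ℂ V) (q : V → ℝ)
    (hadd : ∀ v ∈ X, ∀ w ∈ X, q (v + w) ≤ q v + q w)
    (hsmul : ∀ (c : ℂ), ∀ v ∈ X, q (c • v) ≤ ‖c‖ * q v)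
    (h0 : ∀ v, 0 ≤ q v)
    (l : M →ₗ[ℂ] V →ₗ[ℂ] V) (hlX : ∀ m, ∀ v ∈ X, l m v ∈ X)
    (hu : ∀ u ∈ unitary M, ∀ v ∈ X, q (l u v) ≤ q v) (m : M) (v : V) (hv : v ∈ X) :
    q (l m v) ≤ 2 * ‖m‖ * q v := by
  obtain ⟨u, c, hm, hc⟩ := CStarAlgebra.exists_sum_four_unitary m
  have key : ∀ i, q (c i • l (u i : M) v) ≤ ‖m‖ / 2 * q v := fun i =>
    (hsmul _ _ (hlX _ _ hv)).trans (by
      have := hu _ (u i).2 v hv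
      have := hc i
      have := h0 v
      have := h0 (l (u i : M) v)
      gcongr)
  have mem : ∀ i, c i • l (u i : M) v ∈ X := fun i => X.smul_mem _ (hlX _ _ hv)
  have e : l m v = c 0 • l (u 0 : M) v + c 1 • l (u 1 : M) v + c 2 • l (u 2 : M) v
      + c 3 • l (u 3 : M) v := by
    conv_lhs => rw [hm]
    simp [Fin.sum_univ_four]
  rw [e]
  have a1 := hadd _ (X.add_mem (X.add_mem (mem 0) (mem 1)) (mem 2)) _ (mem 3)
  have a2 := hadd _ (X.add_mem (mem 0) (mem 1)) _ (mem 2)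
  have a3 := hadd _ (mem 0) _ (mem 1)
  linarith [key 0, key 1, key 2, key 3]

section Compl
open UniformSpace Completion

/-- Cauchy-Schwarz for finite families in a C*-algebra -/
lemma cs_cstar {C ι : Type*} [NonUnitalCStarAlgebra C] [Fintype ι] (a b : ι → C) :
    ‖∑ k, star (a k) * b k‖ ^ 2 ≤ ‖∑ k, star (a k) * a k‖ * ‖∑ k, star (b k) * b k‖ := by
  letI := CStarAlgebra.spectralOrder C
  letI := CStarAlgebra.spectralOrderedRing C
  let x : WithCStarModule C (ι → C) := (WithCStarModule.equiv C _).symm (fun k => star (b k))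
  let y : WithCStarModule C (ι → C) := (WithCStarModule.equiv C _).symm (fun k => star (a k))
  have h := CStarModule.norm_inner_le (A := C) (WithCStarModule C (ι → C)) (x := x) (y := y)
  have hx := WithCStarModule.pi_norm_sq x
  have hy := WithCStarModule.pi_norm_sq y
  rw [WithCStarModule.pi_inner] at h
  simp only [x, y, WithCStarModule.inner_def, WithCStarModule.equiv_symm_pi_apply, star_star] at h hx hy
  rw [← hx, ← hy, ← mul_pow, mul_comm]
  gcongr

variable {T : Type*} [NonUnitalSeminormedRing T] [StarRing T] [NormedSpace ℂ T]
  [IsScalarTower ℂ T T] [SMulCommClass ℂ T T] [StarModule ℂ T]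

class PreCS (T : Type*) [NonUnitalSeminormedRing T] [StarRing T] : Prop where
  hT : ∀ x : T, ‖star x * x‖ = ‖x‖ ^ 2
  hst : ∀ x : T, ‖star x‖ = ‖x‖

lemma cpl_csm (c : ℂ) : Continuous (fun x : Completion T => c • x) :=
  Completion.continuous_map

instance cplMul : Mul (Completion T) := ⟨Function.curry <| ((isDenseInducing_coe (α := T)).prodMap
    isDenseInducing_coe).extend ((↑) ∘ Function.uncurry (· * ·))⟩

lemma cpl_mul (a b : T) : ((a * b : T) : Completion T) = (a : Completion T) * (b : Completion T) :=
    ((isDenseInducing_coe.prodMap isDenseInducing_coe).extend_eq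
      ((continuous_coe T).comp (continuous_mul (M := T))) (a, b)).symm

instance cplCM : ContinuousMul (Completion T) := ⟨by
    let m := (AddMonoidHom.mul : T →+ T →+ T).compr₂ toCompl
    have : Continuous fun p : T × T => m p.1 p.2 := (continuous_coe T).comp continuous_mul
    have di : IsDenseInducing (toCompl : T → Completion T) := isDenseInducing_coe
    exact (di.extend_Z_bilin di this :)⟩

instance cplNUR : NonUnitalRing (Completion T) :=
  { (inferInstance : AddCommGroup (Completion T)), (inferInstance : Mul (Completion T)) with
    zero_mul := fun a =>
      Completion.induction_on a (isClosed_eq (by fun_prop) continuous_const)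
        fun a => by rw [← Completion.coe_zero, ← cpl_mul, zero_mul]
    mul_zero := fun a =>
      Completion.induction_on a (isClosed_eq (by fun_prop) continuous_const)
        fun a ↦ by rw [← Completion.coe_zero, ← cpl_mul, mul_zero]
    mul_assoc := fun a b c =>
      Completion.induction_on₃ a b c
        (isClosed_eq (by fun_prop) (by fun_prop))
        fun a b c => by simp only [← cpl_mul, mul_assoc]
    left_distrib := fun a b c =>
      Completion.induction_on₃ a b c
        (isClosed_eq (by fun_prop) (by fun_prop))
        fun a b c => by simp only [← cpl_mul, mul_add, ← Completion.coe_add]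
    right_distrib := fun a b c =>
      Completion.induction_on₃ a b c
        (isClosed_eq (by fun_prop) (by fun_prop))
        fun a b c => by simp only [← cpl_mul, add_mul, ← Completion.coe_add] }

lemma cpl_norm_mul (x y : Completion T) : ‖x * y‖ ≤ ‖x‖ * ‖y‖ :=
  Completion.induction_on₂ x y (isClosed_le (by fun_prop) (by fun_prop))
      fun x y => by
        rw [← cpl_mul, Completion.norm_coe, Completion.norm_coe, Completion.norm_coe]
        exact norm_mul_le x y

instance cplNUNR : NonUnitalNormedRing (Completion T) :=
  { (inferInstance : NormedAddCommGroup (Completion T)), cplNUR (T := T) with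
    norm_mul_le := cpl_norm_mul }

lemma star_uc [PreCS T] : UniformContinuous (star : T → T) :=
  (AddMonoidHomClass.isometry_of_norm (starAddEquiv : T ≃+ T) PreCS.hst).uniformContinuous

instance cplStar : Star (Completion T) := ⟨Completion.map (star : T → T)⟩

lemma cpl_star [PreCS T] (a : T) : ((star a : T) : Completion T) = star (a : Completion T) :=
  (Completion.map_coe star_uc a).symm

lemma cpl_cs : Continuous (star : Completion T → Completion T) := Completion.continuous_map

instance cplSR [PreCS T] : StarRing (Completion T) where
    star_involutive := fun a => Completion.induction_on a
      (isClosed_eq (cpl_cs.comp cpl_cs) continuous_id) fun a => by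
        rw [← cpl_star, ← cpl_star, star_star]
    star_mul := fun a b => Completion.induction_on₂ a b
      (isClosed_eq (cpl_cs.comp (by fun_prop))
        ((cpl_cs.comp continuous_snd).mul (cpl_cs.comp continuous_fst))) fun a b => by
        simp only [← cpl_mul, ← cpl_star, star_mul]
    star_add := fun a b => Completion.induction_on₂ a b
      (isClosed_eq (cpl_cs.comp (by fun_prop))
        ((cpl_cs.comp continuous_fst).add (cpl_cs.comp continuous_snd))) fun a b => by
        simp only [← Completion.coe_add, ← cpl_star, star_add]

instance cplCS [PreCS T] : CStarRing (Completion T) := ⟨fun x => Completion.induction_on x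
    (isClosed_le (by fun_prop) ((cpl_cs.mul continuous_id).norm))
    fun x => by
      rw [← cpl_star, ← cpl_mul, Completion.norm_coe, Completion.norm_coe, PreCS.hT, sq]⟩
instance cplIST : IsScalarTower ℂ (Completion T) (Completion T) := ⟨fun c x y => by
    simp only [smul_eq_mul]
    exact Completion.induction_on₂ x y (isClosed_eq
      (((cpl_csm c).comp continuous_fst).mul continuous_snd)
      ((cpl_csm c).comp (continuous_fst.mul continuous_snd))) fun x y => by
      simp only [← Completion.coe_smul, ← cpl_mul, smul_mul_assoc]⟩
instance cplSCC : SMulCommClass ℂ (Completion T) (Completion T) := ⟨fun c x y => by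
    simp only [smul_eq_mul]
    exact Completion.induction_on₂ x y (isClosed_eq
      ((cpl_csm c).comp (continuous_fst.mul continuous_snd))
      (continuous_fst.mul ((cpl_csm c).comp continuous_snd))) fun x y => by
      simp only [← Completion.coe_smul, ← cpl_mul, mul_smul_comm]⟩
instance cplSM [PreCS T] : StarModule ℂ (Completion T) := ⟨fun c x =>
    Completion.induction_on x (isClosed_eq (cpl_cs.comp (cpl_csm c)) ((cpl_csm _).comp cpl_cs))
     fun x => by
      rw [← Completion.coe_smul, ← cpl_star, ← cpl_star, star_smul, ← Completion.coe_smul]⟩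
instance cplCSA [PreCS T] : NonUnitalCStarAlgebra (Completion T) :=
  { cplNUNR (T := T), (inferInstance : NormedSpace ℂ (Completion T)), cplSR (T := T),
    cplCS (T := T), cplIST (T := T), cplSCC (T := T), cplSM (T := T),
    (inferInstance : CompleteSpace (Completion T)) with }

lemma cs_seminormed {ι : Type*} [Fintype ι] [PreCS T] (a b : ι → T) :
    ‖∑ k, star (a k) * b k‖ ^ 2 ≤ ‖∑ k, star (a k) * a k‖ * ‖∑ k, star (b k) * b k‖ := by
  have coe_sum : ∀ f : ι → T, ((∑ k, f k : T) : Completion T) = ∑ k, (f k : Completion T) :=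
    fun f => map_sum (toCompl (α := T)) f _
  have := cs_cstar (C := Completion T) (fun k => (a k : Completion T)) (fun k => (b k : Completion T))
  simp only [← cpl_star, ← cpl_mul, ← coe_sum] at this
  rwa [Completion.norm_coe, Completion.norm_coe, Completion.norm_coe] at this

end Compl

lemma CSN.cs {T : Type*} [NonUnitalRing T] [StarRing T] [Module ℂ T]
    [IsScalarTower ℂ T T] [SMulCommClass ℂ T T] [StarModule ℂ T] {γ : T → ℝ} (h : CSN γ)
    {ι : Type*} [Fintype ι] (a b : ι → T) :
    γ (∑ k, star (a k) * b k) ^ 2 ≤ γ (∑ k, star (a k) * a k) * γ (∑ k, star (b k) * b k) := by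
  let g : AddGroupSeminorm T :=
    { toFun := γ, map_zero' := h.zero, add_le' := h.add_le, neg' := h.neg }
  letI : SeminormedAddCommGroup T := g.toSeminormedAddCommGroup
  letI : NonUnitalSeminormedRing T := { this, (inferInstance : NonUnitalRing T) with
    norm_mul_le := h.mul_le }
  letI : NormedSpace ℂ T := { norm_smul_le := h.smul_le }
  have : PreCS T := ⟨h.cstar, h.star_eq⟩
  exact cs_seminormed a b

section Tens
variable {A B I E D : Type} [NonUnitalCStarAlgebra A] [NonUnitalCStarAlgebra B]
  [NonUnitalCStarAlgebra D] [NonUnitalCStarAlgebra I] [NonUnitalCStarAlgebra E]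

lemma tensor_star_mul (x y : A ⊗[ℂ] D) : star (x * y) = star y * star x := by
  induction x using TensorProduct.induction_on with
  | zero => simp
  | add a b ha hb => rw [add_mul, star_add, star_add, mul_add, ha, hb]
  | tmul a d =>
    induction y using TensorProduct.induction_on with
    | zero => simp
    | add a b ha hb => rw [mul_add, star_add, star_add, add_mul, ha, hb]
    | tmul a' d' =>
      simp [TensorProduct.star_tmul]

instance tensorStarRing : StarRing (A ⊗[ℂ] D) :=
  { (inferInstance : StarAddMonoid (A ⊗[ℂ] D)) with star_mul := tensor_star_mul }

lemma tensor_star_unique {s : TensorProduct ℂ A D →+ TensorProduct ℂ A D} (hs : IsTensorStar s)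
    (x : A ⊗[ℂ] D) : s x = star x := by
  induction x using TensorProduct.induction_on with
  | zero => simp
  | add a b ha hb => rw [map_add, star_add, ha, hb]
  | tmul a d => rw [hs, TensorProduct.star_tmul]

lemma csn_of {s : TensorProduct ℂ A D →+ TensorProduct ℂ A D} (hs : IsTensorStar s)
    {γ : A ⊗[ℂ] D → ℝ} (h : IsCStarSeminorm s γ) : CSN γ :=
  ⟨h.nonneg, h.add_le, fun c x => (h.smul c x).le, h.mul_le, fun x => by
    rw [← tensor_star_unique hs, h.cstar]⟩

lemma of_csn {γ : A ⊗[ℂ] D → ℝ} (h : CSN γ) :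
    IsCStarSeminorm ((starAddEquiv : A ⊗[ℂ] D ≃+ A ⊗[ℂ] D) : A ⊗[ℂ] D →+ A ⊗[ℂ] D) γ :=
  ⟨h.nonneg, h.add_le, h.smul, h.mul_le, h.cstar⟩

lemma nb_iff {ρ : A →ₗ[ℂ] B} {K : ℝ} : NuclearBound ρ K ↔
    ∀ (D : Type) [NonUnitalCStarAlgebra D] (γ : A ⊗[ℂ] D → ℝ) (δ : B ⊗[ℂ] D → ℝ),
      CSN γ → (∀ x, γ x = 0 → x = 0) → CSN δ →
      ∀ x, δ (TensorProduct.map ρ (LinearMap.id : D →ₗ[ℂ] D) x) ≤ K * γ x := by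
  constructor
  · intro h D _ γ δ hγ hγ0 hδ x
    exact h D _ _ γ δ (fun a d => TensorProduct.star_tmul a d)
      (fun a d => TensorProduct.star_tmul a d) ⟨of_csn hγ, hγ0⟩ (of_csn hδ) x
  · intro h D _ sA sB γ δ hA hB hγ hδ x
    exact h D γ δ (csn_of hA hγ.toIsCStarSeminorm) hγ.definite (csn_of hB hδ) x

/-- pullback of a C*-seminorm along a star hom tensor star hom -/
lemma map_star_mul (f : A →⋆ₙₐ[ℂ] B) (x y : A ⊗[ℂ] D) :
    TensorProduct.map (f : A →ₗ[ℂ] B) (LinearMap.id : D →ₗ[ℂ] D) (x * y) =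
    TensorProduct.map (f : A →ₗ[ℂ] B) (LinearMap.id : D →ₗ[ℂ] D) x *
    TensorProduct.map (f : A →ₗ[ℂ] B) (LinearMap.id : D →ₗ[ℂ] D) y := by
  induction x using TensorProduct.induction_on with
  | zero => simp
  | add a b ha hb => rw [add_mul, map_add, map_add, add_mul, ha, hb]
  | tmul a d =>
    induction y using TensorProduct.induction_on with
    | zero => simp
    | add a b ha hb => rw [mul_add, map_add, map_add, mul_add, ha, hb]
    | tmul a' d' => simp

lemma map_star_star (f : A →⋆ₙₐ[ℂ] B) (x : A ⊗[ℂ] D) :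
    TensorProduct.map (f : A →ₗ[ℂ] B) (LinearMap.id : D →ₗ[ℂ] D) (star x) =
    star (TensorProduct.map (f : A →ₗ[ℂ] B) (LinearMap.id : D →ₗ[ℂ] D) x) := by
  induction x using TensorProduct.induction_on with
  | zero => simp
  | add a b ha hb => rw [star_add, map_add, map_add, star_add, ha, hb]
  | tmul a d => simp [TensorProduct.star_tmul, map_star]

lemma csn_pull (f : A →⋆ₙₐ[ℂ] B) {δ : B ⊗[ℂ] D → ℝ} (h : CSN δ) :
    CSN (fun x : A ⊗[ℂ] D =>
      δ (TensorProduct.map (f : A →ₗ[ℂ] B) (LinearMap.id : D →ₗ[ℂ] D) x)) where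
  nonneg x := h.nonneg _
  add_le x y := by rw [map_add]; exact h.add_le _ _
  smul_le c x := by rw [map_smul]; exact h.smul_le _ _
  mul_le x y := by rw [map_star_mul]; exact h.mul_le _ _
  cstar_le x := by rw [map_star_mul, map_star_star]; exact h.cstar_le _

lemma comm_mul (x y : A ⊗[ℂ] D) : TensorProduct.comm ℂ A D (x * y) =
    TensorProduct.comm ℂ A D x * TensorProduct.comm ℂ A D y := by
  induction x using TensorProduct.induction_on with
  | zero => simp
  | add a b ha hb => rw [add_mul, map_add, map_add, add_mul, ha, hb]
  | tmul a d =>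
    induction y using TensorProduct.induction_on with
    | zero => simp
    | add a b ha hb => rw [mul_add, map_add, map_add, mul_add, ha, hb]
    | tmul a' d' => simp

lemma comm_star (x : A ⊗[ℂ] D) : TensorProduct.comm ℂ A D (star x) =
    star (TensorProduct.comm ℂ A D x) := by
  induction x using TensorProduct.induction_on with
  | zero => simp
  | add a b ha hb => rw [star_add, map_add, map_add, star_add, ha, hb]
  | tmul a d => simp [TensorProduct.star_tmul]

lemma csn_comm {δ : D ⊗[ℂ] A → ℝ} (h : CSN δ) :
    CSN (fun x : A ⊗[ℂ] D => δ (TensorProduct.comm ℂ A D x)) where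
  nonneg x := h.nonneg _
  add_le x y := by rw [map_add]; exact h.add_le _ _
  smul_le c x := by rw [map_smul]; exact h.smul_le _ _
  mul_le x y := by rw [comm_mul]; exact h.mul_le _ _
  cstar_le x := by rw [comm_mul, comm_star]; exact h.cstar_le _

/-- maps preserving inner products -/
lemma inner_map (f : A →ₗ[ℂ] A) (hf : ∀ a a', star (f a) * f a' = star a * a')
    (x y : A ⊗[ℂ] D) :
    star (TensorProduct.map f (LinearMap.id : D →ₗ[ℂ] D) x) *
      TensorProduct.map f (LinearMap.id : D →ₗ[ℂ] D) y = star x * y := by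
  induction x using TensorProduct.induction_on with
  | zero => simp
  | add a b ha hb => rw [map_add, star_add, add_mul, star_add, add_mul, ha, hb]
  | tmul a d =>
    induction y using TensorProduct.induction_on with
    | zero => simp
    | add a b ha hb => rw [map_add, mul_add, mul_add, ha, hb]
    | tmul a' d' => simp [TensorProduct.star_tmul, hf]

/-- the left multiplication action of `E` on an ideal `I` -/
def idealL (j : I →⋆ₙₐ[ℂ] E) (hj : IsIdealEmbedding j) : E →ₗ[ℂ] I →ₗ[ℂ] I :=
  LinearMap.mk₂ ℂ (fun e b => (hj.mul_mem_left e b).choose)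
    (fun e e' b => hj.inj (by
      rw [map_add, (hj.mul_mem_left _ b).choose_spec, (hj.mul_mem_left _ b).choose_spec,
        (hj.mul_mem_left _ b).choose_spec, add_mul]))
    (fun c e b => hj.inj (by
      rw [map_smul, (hj.mul_mem_left _ b).choose_spec, (hj.mul_mem_left _ b).choose_spec,
        smul_mul_assoc]))
    (fun e b b' => hj.inj (by
      have h1 := (hj.mul_mem_left e (b + b')).choose_spec
      refine h1.trans ?_
      rw [map_add, map_add, (hj.mul_mem_left e b).choose_spec,
        (hj.mul_mem_left e b').choose_spec, mul_add]))
    (fun c e b => hj.inj (by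
      have h1 := (hj.mul_mem_left e (c • b)).choose_spec
      refine h1.trans ?_
      rw [map_smul, map_smul, (hj.mul_mem_left e b).choose_spec, mul_smul_comm]))

lemma idealL_spec (j : I →⋆ₙₐ[ℂ] E) (hj : IsIdealEmbedding j) (e : E) (b : I) :
    j (idealL j hj e b) = e * j b := (hj.mul_mem_left e b).choose_spec

lemma left_bound {j : I →⋆ₙₐ[ℂ] E} (hj : IsIdealEmbedding j) {e : E} {f : I →ₗ[ℂ] I}
    (hf : ∀ b, j (f b) = e * j b) {δ : I ⊗[ℂ] D → ℝ} (h : CSN δ) (t : I ⊗[ℂ] D) :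
    δ (TensorProduct.map f (LinearMap.id : D →ₗ[ℂ] D) t) ≤ 2 * ‖e‖ * δ t := by
  let l₀ : Unitization ℂ E →ₗ[ℂ] I →ₗ[ℂ] I :=
    { toFun := fun m => m.fst • LinearMap.id + idealL j hj m.snd
      map_add' := fun m m' => by ext; simp [add_smul]; abel
      map_smul' := fun c m => by ext; simp [smul_smul] }
  have hl₀ : ∀ m b, ((j (l₀ m b) : E) : Unitization ℂ E) = m * ((j b : E) : Unitization ℂ E) := by
    intro m b
    ext
    · simp
    · simp [l₀, idealL_spec]
  let l : Unitization ℂ E →ₗ[ℂ] (I ⊗[ℂ] D) →ₗ[ℂ] (I ⊗[ℂ] D) := (LinearMap.rTensorHom D).comp l₀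
  have hl : ∀ m t, l m t = TensorProduct.map (l₀ m) LinearMap.id t := fun m t => rfl
  have hu : ∀ u ∈ unitary (Unitization ℂ E), ∀ v ∈ (⊤ : Submodule ℂ (I ⊗[ℂ] D)),
      δ (l u v) ≤ δ v := by
    intro u hu v _
    have h1 : ∀ a a', star (l₀ u a) * l₀ u a' = star a * a' := by
      intro a a'
      apply hj.inj
      apply Unitization.inr_injective (R := ℂ)
      rw [map_mul, map_star, Unitization.inr_mul, Unitization.inr_star, hl₀, hl₀, star_mul,
        mul_assoc, ← mul_assoc (star u), Unitary.star_mul_self_of_mem hu, one_mul,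
        map_mul, map_star, Unitization.inr_mul, Unitization.inr_star]
    have h2 := inner_map (l₀ u) h1 v v
    have h3 := congrArg δ h2
    rw [← hl, h.cstar, h.cstar] at h3
    exact ((sq_eq_sq₀ (h.nonneg _) (h.nonneg _)).1 h3).le
  have key := unitary_bound ⊤ δ (fun v _ w _ => h.add_le v w) (fun c v _ => h.smul_le c v)
    h.nonneg l (fun _ _ _ => trivial) hu (e : Unitization ℂ E) t trivial
  rw [Unitization.norm_inr, hl] at key
  have : l₀ (e : Unitization ℂ E) = f := by
    ext b
    apply hj.inj
    simp [l₀, idealL_spec, hf]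
  rwa [this] at key

/-- `star ∘ f ∘ star` -/
def starConj (f : I →ₗ[ℂ] I) : I →ₗ[ℂ] I where
  toFun b := star (f (star b))
  map_add' b c := by simp
  map_smul' c b := by simp

lemma starConj_map (f : I →ₗ[ℂ] I) (t : I ⊗[ℂ] D) :
    TensorProduct.map (starConj f) (LinearMap.id : D →ₗ[ℂ] D) (star t) =
    star (TensorProduct.map f (LinearMap.id : D →ₗ[ℂ] D) t) := by
  induction t using TensorProduct.induction_on with
  | zero => simp
  | add a b ha hb => rw [star_add, map_add, map_add, star_add, ha, hb]
  | tmul a d => simp [TensorProduct.star_tmul, starConj]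

lemma right_bound {j : I →⋆ₙₐ[ℂ] E} (hj : IsIdealEmbedding j) {e : E} {f : I →ₗ[ℂ] I}
    (hf : ∀ b, j (f b) = j b * e) {δ : I ⊗[ℂ] D → ℝ} (h : CSN δ) (t : I ⊗[ℂ] D) :
    δ (TensorProduct.map f (LinearMap.id : D →ₗ[ℂ] D) t) ≤ 2 * ‖e‖ * δ t := by
  have := left_bound hj (e := star e) (f := starConj f)
    (fun b => by simp [starConj, map_star, hf]) h (star t)
  rwa [starConj_map, h.star_eq, h.star_eq, norm_star] at this

lemma id_ideal : IsIdealEmbedding (NonUnitalStarAlgHom.id ℂ I) where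
  inj := fun _ _ h => h
  closed := by
    have : Set.range (NonUnitalStarAlgHom.id ℂ I) = Set.univ := Set.eq_univ_of_forall fun x => ⟨x, rfl⟩
    rw [this]; exact isClosed_univ
  mul_mem_left e b := ⟨e * b, rfl⟩
  mul_mem_right e b := ⟨b * e, rfl⟩

lemma lmul_bound {δ : I ⊗[ℂ] D → ℝ} (h : CSN δ) (b : I) (t : I ⊗[ℂ] D) :
    δ (TensorProduct.map (LinearMap.mulLeft ℂ b) (LinearMap.id : D →ₗ[ℂ] D) t) ≤ 2 * ‖b‖ * δ t :=
  left_bound id_ideal (e := b) (fun _ => rfl) h t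

lemma rmul_bound {δ : I ⊗[ℂ] D → ℝ} (h : CSN δ) (b : I) (t : I ⊗[ℂ] D) :
    δ (TensorProduct.map (LinearMap.mulRight ℂ b) (LinearMap.id : D →ₗ[ℂ] D) t) ≤ 2 * ‖b‖ * δ t :=
  right_bound id_ideal (e := b) (fun _ => rfl) h t

lemma lmul_bound' {δ : I ⊗[ℂ] D → ℝ} (h : CSN δ) (d : D) (t : I ⊗[ℂ] D) :
    δ (TensorProduct.map (LinearMap.id : I →ₗ[ℂ] I) (LinearMap.mulLeft ℂ d) t) ≤ 2 * ‖d‖ * δ t := by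
  have := lmul_bound (csn_comm h) d (TensorProduct.comm ℂ I D t)
  have e : ∀ t : I ⊗[ℂ] D, TensorProduct.comm ℂ D I (TensorProduct.comm ℂ I D t) = t := fun t => by
    induction t using TensorProduct.induction_on with
    | zero => simp
    | add a b ha hb => rw [map_add, map_add, ha, hb]
    | tmul a d => simp
  rw [e] at this
  convert this using 2
  clear this
  induction t using TensorProduct.induction_on with
    | zero => simp
    | add a b ha hb => simp only [map_add, ha, hb] 
    | tmul a d => simp

lemma cross_bound {δ : I ⊗[ℂ] D → ℝ} (h : CSN δ) (b : I) (d : D) :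
    δ (b ⊗ₜ[ℂ] d) ≤ 4 * ‖b‖ * ‖d‖ := by
  have h1 := h.cstar (star (b ⊗ₜ[ℂ] d))
  have h2 := lmul_bound h b (TensorProduct.map (LinearMap.id : I →ₗ[ℂ] I) (LinearMap.mulLeft ℂ d)
    (star (b ⊗ₜ[ℂ] d)))
  have h3 := lmul_bound' h d (star (b ⊗ₜ[ℂ] d))
  rw [star_star] at h1
  have h4 : (b ⊗ₜ[ℂ] d) * star (b ⊗ₜ[ℂ] d) = TensorProduct.map (LinearMap.mulLeft ℂ b)
    (LinearMap.id : D →ₗ[ℂ] D) (TensorProduct.map (LinearMap.id : I →ₗ[ℂ] I) (LinearMap.mulLeft ℂ d)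
    (star (b ⊗ₜ[ℂ] d))) := by simp [TensorProduct.star_tmul]
  rw [← h4, h1] at h2
  rw [h.star_eq] at h2 h3
  rcases (h.nonneg (b ⊗ₜ[ℂ] d)).eq_or_lt with h0 | h0
  · rw [← h0]; positivity
  · have h5 : δ (b ⊗ₜ[ℂ] d) ^ 2 ≤ (4 * ‖b‖ * ‖d‖) * δ (b ⊗ₜ[ℂ] d) := by
      have := norm_nonneg b
      nlinarith [mul_le_mul_of_nonneg_left h3 (norm_nonneg b)]
    rw [sq] at h5
    exact le_of_mul_le_mul_right h5 h0

open Filter Topology in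
/-- pointwise convergence of maps gives convergence of seminorms -/
lemma tendsto_map {V : Type} [AddCommGroup V] [Module ℂ V] {δ : I ⊗[ℂ] D → ℝ} (h : CSN δ)
    {α : Type*} {F : Filter α}
    (f : α → V →ₗ[ℂ] I) (g : V →ₗ[ℂ] I) (hfg : ∀ v, Tendsto (fun n => f n v) F (𝓝 (g v)))
    (t : V ⊗[ℂ] D) :
    Tendsto (fun n => δ (TensorProduct.map (f n) LinearMap.id t -
      TensorProduct.map g (LinearMap.id : D →ₗ[ℂ] D) t)) F (𝓝 0) := by
  induction t using TensorProduct.induction_on with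
  | zero => simp [h.zero, tendsto_const_nhds]
  | add a b ha hb =>
    refine squeeze_zero (fun _ => h.nonneg _) (fun n => ?_) (by simpa using ha.add hb)
    rw [map_add, map_add, add_sub_add_comm]
    exact h.add_le _ _
  | tmul v d =>
    refine squeeze_zero (g := fun n => 4 * ‖f n v - g v‖ * ‖d‖) (fun _ => h.nonneg _)
      (fun n => ?_) ?_
    · rw [TensorProduct.map_tmul, TensorProduct.map_tmul, ← TensorProduct.sub_tmul]
      exact cross_bound h _ _
    · have := (tendsto_iff_norm_sub_tendsto_zero.1 (hfg v))
      simpa using (this.const_mul 4).mul_const ‖d‖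

open Filter Topology in
lemma tendsto_map_le {V : Type} [AddCommGroup V] [Module ℂ V] {δ : I ⊗[ℂ] D → ℝ} (h : CSN δ)
    {α : Type*} {F : Filter α} [F.NeBot]
    (f : α → V →ₗ[ℂ] I) (g : V →ₗ[ℂ] I) (hfg : ∀ v, Tendsto (fun n => f n v) F (𝓝 (g v)))
    (t : V ⊗[ℂ] D) (C : ℝ)
    (hC : ∀ᶠ n in F, δ (TensorProduct.map (f n) (LinearMap.id : D →ₗ[ℂ] D) t) ≤ C) :
    δ (TensorProduct.map g (LinearMap.id : D →ₗ[ℂ] D) t) ≤ C := by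
  have h1 := (tendsto_map h f g hfg t).add_const C
  refine ge_of_tendsto (by simpa using h1) ?_
  filter_upwards [hC] with n hn
  have := h.sub_le (TensorProduct.map (f n) (LinearMap.id : D →ₗ[ℂ] D) t)
    (TensorProduct.map (f n) LinearMap.id t - TensorProduct.map g (LinearMap.id : D →ₗ[ℂ] D) t)
  rw [sub_sub_cancel] at this
  linarith

end Tens

section Nuc
variable {A B C I E : Type} [NonUnitalCStarAlgebra A] [NonUnitalCStarAlgebra B]
  [NonUnitalCStarAlgebra C] [NonUnitalCStarAlgebra I] [NonUnitalCStarAlgebra E]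

lemma hom_cont (f : A →⋆ₙₐ[ℂ] B) : Continuous f :=
  AddMonoidHomClass.continuous_of_bound f 1 fun x => by
    rw [one_mul]; exact NonUnitalStarAlgHom.norm_apply_le f x

lemma nuc_add {ρ σ : A →ₗ[ℂ] B} (h1 : IsNuclearMap ρ) (h2 : IsNuclearMap σ) :
    IsNuclearMap (ρ + σ) := by
  obtain ⟨K, hK, h1⟩ := h1
  obtain ⟨L, hL, h2⟩ := h2
  refine ⟨K + L, by positivity, nb_iff.2 fun D _ γ δ hγ hγ0 hδ x => ?_⟩
  rw [TensorProduct.map_add_left, LinearMap.add_apply, add_mul]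
  exact (hδ.add_le _ _).trans (add_le_add (nb_iff.1 h1 D γ δ hγ hγ0 hδ x)
    (nb_iff.1 h2 D γ δ hγ hγ0 hδ x))

lemma nuc_smul {ρ : A →ₗ[ℂ] B} (c : ℂ) (h1 : IsNuclearMap ρ) :
    IsNuclearMap (c • ρ) := by
  obtain ⟨K, hK, h1⟩ := h1
  refine ⟨‖c‖ * K, by positivity, nb_iff.2 fun D _ γ δ hγ hγ0 hδ x => ?_⟩
  rw [TensorProduct.map_smul_left, LinearMap.smul_apply, hδ.smul, mul_assoc]
  have := nb_iff.1 h1 D γ δ hγ hγ0 hδ x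
  gcongr

lemma nuc_sub {ρ σ : A →ₗ[ℂ] B} (h1 : IsNuclearMap ρ) (h2 : IsNuclearMap σ) :
    IsNuclearMap (ρ - σ) := by
  have := nuc_add h1 (nuc_smul (-1) h2)
  rwa [neg_one_smul, ← sub_eq_add_neg] at this

lemma nuc_zero : IsNuclearMap (0 : A →ₗ[ℂ] B) := by
  refine ⟨0, le_rfl, nb_iff.2 fun D _ γ δ hγ hγ0 hδ x => ?_⟩
  rw [TensorProduct.map_zero_left, LinearMap.zero_apply, hδ.zero, zero_mul]

lemma nuc_comp (f : B →⋆ₙₐ[ℂ] C) {ρ : A →ₗ[ℂ] B} (h1 : IsNuclearMap ρ) :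
    IsNuclearMap ((f : B →ₗ[ℂ] C) ∘ₗ ρ) := by
  obtain ⟨K, hK, h1⟩ := h1
  refine ⟨K, hK, nb_iff.2 fun D _ γ δ hγ hγ0 hδ x => ?_⟩
  have := nb_iff.1 h1 D γ _ hγ hγ0 (csn_pull f hδ) x
  rwa [← LinearMap.comp_apply, ← TensorProduct.map_comp, LinearMap.id_comp] at this

/-- ideal multipliers before a homomorphism -/
lemma nuc_left {j : I →⋆ₙₐ[ℂ] E} (hj : IsIdealEmbedding j) (ψ : I →⋆ₙₐ[ℂ] B) {e : E}
    {f : I →ₗ[ℂ] I} (hf : ∀ b, j (f b) = e * j b) {σ : A →ₗ[ℂ] I}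
    (h1 : IsNuclearMap ((ψ : I →ₗ[ℂ] B) ∘ₗ σ)) :
    IsNuclearMap ((ψ : I →ₗ[ℂ] B) ∘ₗ f ∘ₗ σ) := by
  obtain ⟨K, hK, h1⟩ := h1
  refine ⟨2 * ‖e‖ * K, by positivity, nb_iff.2 fun D _ γ δ hγ hγ0 hδ x => ?_⟩
  have := nb_iff.1 h1 D γ _ hγ hγ0 hδ x
  have h2 := left_bound hj hf (csn_pull ψ hδ) (TensorProduct.map σ LinearMap.id x)
  simp only [← LinearMap.comp_apply, ← TensorProduct.map_comp, LinearMap.id_comp] at h2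
  refine h2.trans ?_
  rw [mul_assoc _ K]
  gcongr

lemma nuc_right {j : I →⋆ₙₐ[ℂ] E} (hj : IsIdealEmbedding j) (ψ : I →⋆ₙₐ[ℂ] B) {e : E}
    {f : I →ₗ[ℂ] I} (hf : ∀ b, j (f b) = j b * e) {σ : A →ₗ[ℂ] I}
    (h1 : IsNuclearMap ((ψ : I →ₗ[ℂ] B) ∘ₗ σ)) :
    IsNuclearMap ((ψ : I →ₗ[ℂ] B) ∘ₗ f ∘ₗ σ) := by
  obtain ⟨K, hK, h1⟩ := h1
  refine ⟨2 * ‖e‖ * K, by positivity, nb_iff.2 fun D _ γ δ hγ hγ0 hδ x => ?_⟩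
  have := nb_iff.1 h1 D γ _ hγ hγ0 hδ x
  have h2 := right_bound hj hf (csn_pull ψ hδ) (TensorProduct.map σ LinearMap.id x)
  simp only [← LinearMap.comp_apply, ← TensorProduct.map_comp, LinearMap.id_comp] at h2
  refine h2.trans ?_
  rw [mul_assoc _ K]
  gcongr

lemma nuc_mulRight (b : B) {ρ : A →ₗ[ℂ] B} (h1 : IsNuclearMap ρ) :
    IsNuclearMap (LinearMap.mulRight ℂ b ∘ₗ ρ) := by
  obtain ⟨K, hK, h1⟩ := h1
  refine ⟨2 * ‖b‖ * K, by positivity, nb_iff.2 fun D _ γ δ hγ hγ0 hδ x => ?_⟩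
  have := nb_iff.1 h1 D γ _ hγ hγ0 hδ x
  have h2 := rmul_bound hδ b (TensorProduct.map ρ LinearMap.id x)
  simp only [← LinearMap.comp_apply, ← TensorProduct.map_comp, LinearMap.id_comp] at h2
  refine h2.trans ?_
  rw [mul_assoc _ K]
  gcongr

lemma nuc_mulLeft (b : B) {ρ : A →ₗ[ℂ] B} (h1 : IsNuclearMap ρ) :
    IsNuclearMap (LinearMap.mulLeft ℂ b ∘ₗ ρ) := by
  obtain ⟨K, hK, h1⟩ := h1
  refine ⟨2 * ‖b‖ * K, by positivity, nb_iff.2 fun D _ γ δ hγ hγ0 hδ x => ?_⟩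
  have := nb_iff.1 h1 D γ _ hγ hγ0 hδ x
  have h2 := lmul_bound hδ b (TensorProduct.map ρ LinearMap.id x)
  simp only [← LinearMap.comp_apply, ← TensorProduct.map_comp, LinearMap.id_comp] at h2
  refine h2.trans ?_
  rw [mul_assoc _ K]
  gcongr

lemma nuc_pre (a : A) {ρ : A →ₗ[ℂ] B} (h1 : IsNuclearMap ρ) :
    IsNuclearMap (ρ ∘ₗ LinearMap.mulRight ℂ a) := by
  obtain ⟨K, hK, h1⟩ := h1
  refine ⟨K * (2 * ‖a‖), by positivity, nb_iff.2 fun D _ γ δ hγ hγ0 hδ x => ?_⟩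
  have := nb_iff.1 h1 D γ _ hγ hγ0 hδ (TensorProduct.map (LinearMap.mulRight ℂ a) LinearMap.id x)
  simp only [← LinearMap.comp_apply, ← TensorProduct.map_comp, LinearMap.id_comp] at this
  refine this.trans ?_
  rw [mul_assoc K]
  have := rmul_bound hγ a x
  gcongr

lemma iterate_bound {T : Type*} [NonUnitalRing T] [StarRing T] [Module ℂ T] {γ : T → ℝ}
    (hγ : CSN γ) (p : T → ℝ) (hp0 : ∀ x, 0 ≤ p x) (c K : ℝ) (hc : 0 ≤ c) (hK : 0 ≤ K)
    (hp : ∀ x, p x ≤ K * γ x) (hpp : ∀ x, p x ^ 2 ≤ c * p (star x * x)) (x : T) :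
    p x ≤ c * γ x := by
  have key : ∀ n : ℕ, ∀ x, c * p x ^ (2 ^ n) ≤ (c * γ x) ^ (2 ^ n) * K := by
    intro n
    induction n with
    | zero => intro x; simp; nlinarith [hp x, mul_le_mul_of_nonneg_left (hp x) hc]
    | succ n ih =>
      intro x
      have h1 := ih (star x * x)
      rw [hγ.cstar] at h1
      calc c * p x ^ (2 ^ (n+1)) = c * (p x ^ 2) ^ (2 ^ n) := by rw [← pow_mul, pow_succ']
        _ ≤ c * (c * p (star x * x)) ^ (2 ^ n) := by
          have := hpp x
          gcongr
        _ = c ^ (2 ^ n) * (c * p (star x * x) ^ (2 ^ n)) := by rw [mul_pow]; ring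
        _ ≤ c ^ (2 ^ n) * ((c * γ x ^ 2) ^ 2 ^ n * K) := by gcongr
        _ = ((c * γ x) ^ 2) ^ (2 ^ n) * K := by rw [← mul_assoc, ← mul_pow]; ring_nf
        _ = _ := by rw [← pow_mul, pow_succ']
  by_contra hcon
  push Not at hcon
  rcases hc.eq_or_lt with rfl | hc
  · have := hpp x
    have := hp0 x
    nlinarith
  have hg : 0 < γ x := by
    rcases (hγ.nonneg x).eq_or_lt with h | h
    · have := hp x
      rw [← h] at this hcon
      nlinarith
    · exact h
  have hcg : 0 < c * γ x := by positivity
  have hr : 1 < p x / (c * γ x) := (one_lt_div hcg).2 hcon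
  obtain ⟨n, hn⟩ := pow_unbounded_of_one_lt (K / c) hr
  have h1 : (p x / (c * γ x)) ^ n ≤ (p x / (c * γ x)) ^ (2 ^ n) :=
    pow_le_pow_right₀ hr.le Nat.lt_two_pow_self.le
  have h2 := key n x
  have h3 : (p x / (c * γ x)) ^ (2 ^ n) ≤ K / c := by
    rw [div_pow, div_le_div_iff₀ (by positivity) hc]
    linarith
  linarith

/-- `x ↦ φ(x) y`. -/
def actL (j : I →⋆ₙₐ[ℂ] E) (hj : IsIdealEmbedding j) (φ : A →⋆ₙₐ[ℂ] E) (y : I) : A →ₗ[ℂ] I :=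
  (idealL j hj).flip y ∘ₗ (φ : A →ₗ[ℂ] E)

lemma actL_spec (j : I →⋆ₙₐ[ℂ] E) (hj : IsIdealEmbedding j) (φ : A →⋆ₙₐ[ℂ] E) (y : I) (x : A) :
    j (actL j hj φ y x) = φ x * j y := idealL_spec j hj _ _

lemma key_inner {D : Type} [NonUnitalCStarAlgebra D] (j : I →⋆ₙₐ[ℂ] E) (hj : IsIdealEmbedding j)
    (φ : A →⋆ₙₐ[ℂ] E) (ψ : I →⋆ₙₐ[ℂ] B) (y : I) (X Y : A ⊗[ℂ] D) :
    star (TensorProduct.map ((ψ : I →ₗ[ℂ] B) ∘ₗ actL j hj φ y) (LinearMap.id : D →ₗ[ℂ] D) X) *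
      TensorProduct.map ((ψ : I →ₗ[ℂ] B) ∘ₗ actL j hj φ y) (LinearMap.id : D →ₗ[ℂ] D) Y =
    TensorProduct.map (LinearMap.mulLeft ℂ (ψ (star y))) (LinearMap.id : D →ₗ[ℂ] D)
      (TensorProduct.map ((ψ : I →ₗ[ℂ] B) ∘ₗ actL j hj φ y) (LinearMap.id : D →ₗ[ℂ] D)
        (star X * Y)) := by
  induction X using TensorProduct.induction_on with
  | zero => simp
  | add a b ha hb => simp only [map_add, star_add, add_mul, ha, hb]
  | tmul a d =>
    induction Y using TensorProduct.induction_on with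
    | zero => simp
    | add a b ha hb => simp only [map_add, mul_add, ha, hb]
    | tmul a' d' =>
      simp only [TensorProduct.map_tmul, TensorProduct.star_tmul,
        Algebra.TensorProduct.tmul_mul_tmul, LinearMap.id_apply]
      congr 1
      have : star (actL j hj φ y a) * actL j hj φ y a' = star y * actL j hj φ y (star a * a') := by
        apply hj.inj
        rw [map_mul, map_star, actL_spec, actL_spec, map_mul, actL_spec, star_mul, map_mul,
          map_star, map_star]
        simp only [mul_assoc]
      simpa [map_star] using congrArg ψ this

lemma key_bound {j : I →⋆ₙₐ[ℂ] E} {hj : IsIdealEmbedding j}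
    {φ : A →⋆ₙₐ[ℂ] E} {ψ : I →⋆ₙₐ[ℂ] B} {y : I}
    (h : IsNuclearMap ((ψ : I →ₗ[ℂ] B) ∘ₗ actL j hj φ y)) :
    NuclearBound ((ψ : I →ₗ[ℂ] B) ∘ₗ actL j hj φ y) (2 * ‖y‖) := by
  obtain ⟨K, hK, h⟩ := h
  refine nb_iff.2 fun D _ γ δ hγ hγ0 hδ x => ?_
  refine iterate_bound hγ (fun x => δ (TensorProduct.map ((ψ : I →ₗ[ℂ] B) ∘ₗ actL j hj φ y)
    (LinearMap.id : D →ₗ[ℂ] D) x)) (fun _ => hδ.nonneg _) _ K (by positivity) hK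
    (nb_iff.1 h D γ δ hγ hγ0 hδ) (fun x => ?_) x
  show δ _ ^ 2 ≤ _ * δ _
  rw [← hδ.cstar, key_inner]
  refine (lmul_bound hδ _ _).trans ?_
  have : ‖ψ (star y)‖ ≤ ‖y‖ := by
    rw [← norm_star y]; exact NonUnitalStarAlgHom.norm_apply_le ψ _
  have := hδ.nonneg (TensorProduct.map ((ψ : I →ₗ[ℂ] B) ∘ₗ actL j hj φ y)
    (LinearMap.id : D →ₗ[ℂ] D) (star x * x))
  gcongr

open Filter Topology

lemma nb_of_tendsto {α : Type*} {F : Filter α} [F.NeBot] (f : α → A →ₗ[ℂ] B) (g : A →ₗ[ℂ] B)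
    (hfg : ∀ v, Tendsto (fun n => f n v) F (𝓝 (g v))) (C : ℝ)
    (hC : ∀ᶠ n in F, NuclearBound (f n) C) : NuclearBound g C := by
  refine nb_iff.2 fun D _ γ δ hγ hγ0 hδ x => ?_
  refine tendsto_map_le hδ f g hfg x _ ?_
  filter_upwards [hC] with n hn
  exact nb_iff.1 hn D γ δ hγ hγ0 hδ x

lemma nb_mono {ρ : A →ₗ[ℂ] B} {K L : ℝ} (h : NuclearBound ρ K) (hKL : K ≤ L) :
    NuclearBound ρ L := by
  refine nb_iff.2 fun D _ γ δ hγ hγ0 hδ x => (nb_iff.1 h D γ δ hγ hγ0 hδ x).trans ?_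
  have := hγ.nonneg x
  gcongr

lemma idealL_norm {j : I →⋆ₙₐ[ℂ] E} (hj : IsIdealEmbedding j) (e : E) (y : I) :
    ‖idealL j hj e y‖ ≤ ‖e‖ * ‖y‖ := by
  rw [← NonUnitalStarAlgHom.norm_map j hj.inj, ← NonUnitalStarAlgHom.norm_map j hj.inj y,
    idealL_spec]
  exact norm_mul_le _ _

lemma idealL_cont {j : I →⋆ₙₐ[ℂ] E} (hj : IsIdealEmbedding j) (e : E) :
    Continuous (idealL j hj e) :=
  AddMonoidHomClass.continuous_of_bound (idealL j hj e) ‖e‖ (idealL_norm hj e)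

/-- the set of `y` with nuclear `x ↦ ψ(φ(x)y)` -/
def nucSub (j : I →⋆ₙₐ[ℂ] E) (hj : IsIdealEmbedding j)
    (φ : A →⋆ₙₐ[ℂ] E) (ψ : I →⋆ₙₐ[ℂ] B) : Submodule ℂ I where
  carrier := {y | IsNuclearMap ((ψ : I →ₗ[ℂ] B) ∘ₗ actL j hj φ y)}
  zero_mem' := by
    have : (ψ : I →ₗ[ℂ] B) ∘ₗ actL j hj φ 0 = 0 := by ext; simp [actL]
    simp only [Set.mem_ofPred_eq, this]; exact nuc_zero
  add_mem' {y z} hy hz := by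
    have : (ψ : I →ₗ[ℂ] B) ∘ₗ actL j hj φ (y + z) = (ψ : I →ₗ[ℂ] B) ∘ₗ actL j hj φ y
      + (ψ : I →ₗ[ℂ] B) ∘ₗ actL j hj φ z := by ext; simp [actL]
    simp only [Set.mem_ofPred_eq, this]; exact nuc_add hy hz
  smul_mem' c y hy := by
    have : (ψ : I →ₗ[ℂ] B) ∘ₗ actL j hj φ (c • y) = c • ((ψ : I →ₗ[ℂ] B) ∘ₗ actL j hj φ y) := by
      ext; simp [actL]
    simp only [Set.mem_ofPred_eq, this]; exact nuc_smul c hy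

lemma mem_nucSub {j : I →⋆ₙₐ[ℂ] E} {hj : IsIdealEmbedding j}
    {φ : A →⋆ₙₐ[ℂ] E} {ψ : I →⋆ₙₐ[ℂ] B} {y : I} : y ∈ nucSub j hj φ ψ ↔
    IsNuclearMap ((ψ : I →ₗ[ℂ] B) ∘ₗ actL j hj φ y) := Iff.rfl

lemma nucSub_closed (j : I →⋆ₙₐ[ℂ] E) (hj : IsIdealEmbedding j)
    (φ : A →⋆ₙₐ[ℂ] E) (ψ : I →⋆ₙₐ[ℂ] B) : IsClosed (nucSub j hj φ ψ : Set I) := by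
  refine isClosed_of_closure_subset fun y hy => ?_
  have := mem_closure_iff_nhdsWithin_neBot.1 hy
  refine ⟨2 * (‖y‖ + 1), by positivity, ?_⟩
  refine nb_of_tendsto (F := 𝓝[(nucSub j hj φ ψ : Set I)] y)
    (fun z => (ψ : I →ₗ[ℂ] B) ∘ₗ actL j hj φ z) _ (fun v => ?_) _ ?_
  · have h1 : Continuous fun z => ψ (idealL j hj (φ v) z) :=
      (hom_cont ψ).comp (idealL_cont hj (φ v))
    exact (h1.tendsto y).mono_left nhdsWithin_le_nhds
  · have h1 : ∀ᶠ z in 𝓝[(nucSub j hj φ ψ : Set I)] y, ‖z‖ < ‖y‖ + 1 :=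
      nhdsWithin_le_nhds ((continuous_norm.tendsto y).eventually (gt_mem_nhds (by linarith)))
    filter_upwards [h1, self_mem_nhdsWithin] with z hz hz'
    exact nb_mono (key_bound hz') (by linarith)

end Nuc

section Fact
variable {B : Type} [NonUnitalCStarAlgebra B]

lemma factor_unit {ι : Type*} [Fintype ι] (x : ι → B) (ε : ℝ) (hε : 0 < ε) :
    ∃ k : B, star k = k ∧ ∀ m, ‖x m - k * (∑ i, x i * star (x i)) * k * x m‖ ^ 2 ≤ 2 * ε := by
  letI := CStarAlgebra.spectralOrder B
  letI := CStarAlgebra.spectralOrderedRing B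
  set g : B := ∑ i, x i * star (x i) with hg
  have hg0 : 0 ≤ g := Finset.sum_nonneg fun i _ => mul_star_self_nonneg (x i)
  have hgs : IsSelfAdjoint g := hg0.isSelfAdjoint
  let f : ℝ → ℝ := fun t => √|t| / (|t| + ε)
  have hf : Continuous f := by
    refine Continuous.div (by fun_prop) (by fun_prop) fun t => ?_
    have := abs_nonneg t
    linarith
  have hf0 : f 0 = 0 := by simp [f]
  let φ : ℝ → ℝ := fun t => f t * t * f t
  have hφ : Continuous φ := by fun_prop
  have hφ0 : φ 0 = 0 := by simp [φ]
  let r : ℝ → ℝ := fun t => t - φ t * t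
  have hr : Continuous r := by fun_prop
  have hr0 : r 0 = 0 := by simp [r]
  let s : ℝ → ℝ := fun t => r t - r t * φ t
  have hid : cfcₙ (fun t : ℝ => t) g = g := cfcₙ_id' ℝ g
  set k := cfcₙ f g with hk
  have hks : star k = k := (cfcₙ_predicate (R := ℝ) f g : IsSelfAdjoint _)
  set E := k * g * k with hE
  have hEs : star E = E := by simp [hE, hks, hgs.star_eq, mul_assoc]
  have hEφ : cfcₙ φ g = E := by
    have h1 : cfcₙ (fun t => f t * t * f t) g = cfcₙ (fun t => f t * t) g * cfcₙ f g :=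
      cfcₙ_mul (fun t => f t * t) f g (by fun_prop) (by simp) (by fun_prop) hf0
    have h2 : cfcₙ (fun t => f t * t) g = cfcₙ f g * cfcₙ (fun t => t) g :=
      cfcₙ_mul f (fun t => t) g (by fun_prop) hf0 (by fun_prop) rfl
    rw [h2, hid] at h1
    exact h1
  have hrr : cfcₙ r g = g - E * g := by
    have h1 : cfcₙ (fun t => t - φ t * t) g = cfcₙ (fun t => t) g - cfcₙ (fun t => φ t * t) g :=
      cfcₙ_sub (fun t => t) (fun t => φ t * t) g (by fun_prop) rfl (by fun_prop) (by simp)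
    have h2 : cfcₙ (fun t => φ t * t) g = cfcₙ φ g * cfcₙ (fun t => t) g :=
      cfcₙ_mul φ (fun t => t) g (by fun_prop) hφ0 (by fun_prop) rfl
    rw [h2, hid, hEφ] at h1
    exact h1
  have hss : cfcₙ s g = (g - E * g) - (g - E * g) * E := by
    have h1 : cfcₙ (fun t => r t - r t * φ t) g = cfcₙ r g - cfcₙ (fun t => r t * φ t) g :=
      cfcₙ_sub r (fun t => r t * φ t) g (by fun_prop) hr0 (by fun_prop) (by simp [hr0])
    have h2 : cfcₙ (fun t => r t * φ t) g = cfcₙ r g * cfcₙ φ g :=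
      cfcₙ_mul r φ g (by fun_prop) hr0 (by fun_prop) hφ0
    rw [h2, hrr, hEφ] at h1
    exact h1
  have hnorm : ‖cfcₙ s g‖ ≤ 2 * ε := by
    refine norm_cfcₙ_le fun t ht => ?_
    have ht0 : 0 ≤ t := quasispectrum_nonneg_of_nonneg g hg0 t ht
    have hft : f t * t * f t = t ^ 2 / (t + ε) ^ 2 := by
      simp only [f, abs_of_nonneg ht0]
      have : √t * √t = t := Real.mul_self_sqrt ht0
      field_simp
      nlinarith
    have hte : 0 < t + ε := by linarith
    have hs : s t = t * (1 - t ^ 2 / (t + ε) ^ 2) ^ 2 := by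
      simp only [s, r, φ, hft]; ring
    have h1 : 1 - t ^ 2 / (t + ε) ^ 2 = (2 * t * ε + ε ^ 2) / (t + ε) ^ 2 := by
      field_simp; ring
    have h2 : 0 ≤ 1 - t ^ 2 / (t + ε) ^ 2 := by rw [h1]; positivity
    have h3 : 1 - t ^ 2 / (t + ε) ^ 2 ≤ 1 := by
      have : 0 ≤ t ^ 2 / (t + ε) ^ 2 := by positivity
      linarith
    have h4 : t * (1 - t ^ 2 / (t + ε) ^ 2) ≤ 2 * ε := by
      rw [h1, ← mul_div_assoc, div_le_iff₀ (by positivity)]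
      nlinarith [mul_nonneg ht0 hε.le, mul_nonneg (mul_nonneg ht0 hε.le) hε.le, pow_pos hε 3]
    rw [hs, Real.norm_of_nonneg (by positivity)]
    calc _ = (t * (1 - t ^ 2 / (t + ε) ^ 2)) * (1 - t ^ 2 / (t + ε) ^ 2) := by ring
      _ ≤ (2 * ε) * 1 := by gcongr
      _ = _ := by ring
  refine ⟨k, hks, fun m => ?_⟩
  let y : ι → B := fun i => x i - E * x i
  have hsum : ∑ i, y i * star (y i) = cfcₙ s g := by
    rw [hss]
    have : ∀ i, y i * star (y i) = (x i * star (x i) - E * (x i * star (x i))) -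
        (x i * star (x i) - E * (x i * star (x i))) * E := by
      intro i
      simp only [y, star_sub, star_mul, hEs]
      noncomm_ring
    simp only [this]
    rw [Finset.sum_sub_distrib, ← Finset.sum_mul, Finset.sum_sub_distrib, ← Finset.mul_sum]
  have hle : y m * star (y m) ≤ ∑ i, y i * star (y i) :=
    Finset.single_le_sum (f := fun i => y i * star (y i))
      (fun i _ => mul_star_self_nonneg (y i)) (Finset.mem_univ m)
  have h5 := CStarAlgebra.norm_le_norm_of_nonneg_of_le (mul_star_self_nonneg (y m)) hle
  rw [hsum, CStarRing.norm_self_mul_star, ← sq] at h5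
  exact h5.trans hnorm

open Filter Topology

lemma approx_unit (B : Type) [NonUnitalCStarAlgebra B] : ∃ F : Filter B, F.NeBot ∧
    (∀ᶠ e in F, ‖e‖ ≤ 1) ∧ (∀ a : B, Tendsto (fun e => a * e) F (𝓝 a)) ∧
    (∀ a : B, Tendsto (fun e => e * a) F (𝓝 a)) := by
  letI := CStarAlgebra.spectralOrder B
  letI := CStarAlgebra.spectralOrderedRing B
  have h := CStarAlgebra.increasingApproximateUnit B
  exact ⟨_, h.neBot, h.eventually_norm, h.tendsto_mul_left, h.tendsto_mul_right⟩

end Fact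

section CSF
variable {H B D : Type} [NonUnitalCStarAlgebra H] [NonUnitalCStarAlgebra B]
  [NonUnitalCStarAlgebra D]
open Filter Topology

lemma CSN.tendsto_of {T : Type*} [NonUnitalRing T] [StarRing T] [Module ℂ T] {γ : T → ℝ}
    (h : CSN γ) {α : Type*} {F : Filter α} {s : α → T} {t : T}
    (hs : Tendsto (fun n => γ (s n - t)) F (𝓝 0)) : Tendsto (fun n => γ (s n)) F (𝓝 (γ t)) := by
  rw [tendsto_iff_dist_tendsto_zero]
  refine squeeze_zero (fun _ => dist_nonneg) (fun n => ?_) hs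
  rw [Real.dist_eq, abs_le]
  constructor
  · have := h.sub_le (s n) (s n - t)
    rw [sub_sub_cancel] at this
    linarith
  · have := h.add_le (s n - t) t
    rw [sub_add_cancel] at this
    linarith

lemma tendsto_fam {ι : Type} [Fintype ι] {δ : H ⊗[ℂ] D → ℝ} (hδ : CSN δ)
    (b : ℕ → ι → ι → H) (a : ι → ι → H) (hb : ∀ l m, Tendsto (fun n => b n l m) atTop (𝓝 (a l m)))
    (f : ι → ι → D) :
    Tendsto (fun n => δ (∑ l, ∑ m, b n l m ⊗ₜ[ℂ] f l m)) atTop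
      (𝓝 (δ (∑ l, ∑ m, a l m ⊗ₜ[ℂ] f l m))) := by
  apply hδ.tendsto_of
  refine squeeze_zero (g := fun n => ∑ l, ∑ m, 4 * ‖b n l m - a l m‖ * ‖f l m‖)
    (fun _ => hδ.nonneg _) (fun n => ?_) ?_
  · simp only [← Finset.sum_sub_distrib, ← TensorProduct.sub_tmul]
    refine (hδ.sum_le _ _).trans (Finset.sum_le_sum fun l _ => ?_)
    exact (hδ.sum_le _ _).trans (Finset.sum_le_sum fun m _ => cross_bound hδ _ _)
  · rw [show (0:ℝ) = ∑ l : ι, ∑ m : ι, 4 * 0 * ‖f l m‖ by simp]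
    refine tendsto_finsetSum _ fun l _ => tendsto_finsetSum _ fun m _ => ?_
    exact ((tendsto_iff_norm_sub_tendsto_zero.1 (hb l m)).const_mul 4).mul_const _

lemma cs_fam {jH : H →⋆ₙₐ[ℂ] B} (hj : Function.Injective jH) {ι : Type} [Fintype ι] (x : ι → B)
    (hx : ∀ b l m, ∃ v, jH v = star (x l) * b * x m) (a : ι → ι → H)
    (ha : ∀ l m, jH (a l m) = star (x l) * x m) {δ : H ⊗[ℂ] D → ℝ} (hδ : CSN δ) (d e : ι → D) :
    δ (∑ l, ∑ m, a l m ⊗ₜ[ℂ] (star (d l) * e m)) ^ 2 ≤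
      δ (∑ l, ∑ m, a l m ⊗ₜ[ℂ] (star (d l) * d m)) *
      δ (∑ l, ∑ m, a l m ⊗ₜ[ℂ] (star (e l) * e m)) := by
  have hk : ∀ n : ℕ, ∃ k : B, star k = k ∧ ∀ m,
      ‖x m - k * (∑ i, x i * star (x i)) * k * x m‖ ^ 2 ≤ 2 * (1 / ((n : ℝ) + 1)) :=
    fun n => factor_unit x _ Nat.one_div_pos_of_nat
  choose k hks hk using hk
  choose v hv using hx
  let c : ℕ → ι → ι → H := fun n i l => v (k n) i l
  have hc : ∀ n i l, jH (c n i l) = star (x i) * k n * x l := fun n i l => hv _ _ _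
  let b : ℕ → ι → ι → H := fun n l m => ∑ i, star (c n i l) * c n i m
  have hbj : ∀ n l m, jH (b n l m) =
      star (x l) * (k n * (∑ i, x i * star (x i)) * k n * x m) := by
    intro n l m
    simp only [b, map_sum, map_mul, map_star, hc, star_mul, star_star, hks, Finset.mul_sum,
      Finset.sum_mul, mul_assoc]
  have hb : ∀ l m, Tendsto (fun n => b n l m) atTop (𝓝 (a l m)) := by
    intro l m
    rw [tendsto_iff_norm_sub_tendsto_zero]
    refine squeeze_zero (g := fun n : ℕ => ‖x l‖ * √(2 * (1 / ((n : ℝ) + 1))))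
      (fun _ => norm_nonneg _) (fun n => ?_) ?_
    · rw [← NonUnitalStarAlgHom.norm_map jH hj, map_sub, hbj, ha, ← mul_sub]
      refine (norm_mul_le _ _).trans ?_
      rw [norm_star]
      gcongr
      rw [norm_sub_rev]
      exact Real.le_sqrt_of_sq_le (hk n m)
    · have h1 : Tendsto (fun n : ℕ => 2 * (1 / ((n : ℝ) + 1))) atTop (𝓝 (2 * 0)) :=
        tendsto_one_div_add_atTop_nhds_zero_nat.const_mul 2
      have h2 := ((Real.continuous_sqrt.tendsto _).comp h1).const_mul ‖x l‖
      simpa using h2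
  have hS : ∀ n (d e : ι → D), ∑ l, ∑ m, b n l m ⊗ₜ[ℂ] (star (d l) * e m) =
      ∑ i, star (∑ l, c n i l ⊗ₜ[ℂ] d l) * (∑ m, c n i m ⊗ₜ[ℂ] e m) := by
    intro n d e
    simp only [b, star_sum, TensorProduct.star_tmul, Finset.sum_mul_sum,
      Algebra.TensorProduct.tmul_mul_tmul, TensorProduct.sum_tmul]
    refine (Finset.sum_congr rfl fun l _ => Finset.sum_comm).trans ?_
    rw [Finset.sum_comm]
  refine le_of_tendsto_of_tendsto' ((tendsto_fam hδ b a hb fun l m => star (d l) * e m).pow 2)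
    ((tendsto_fam hδ b a hb fun l m => star (d l) * d m).mul
    (tendsto_fam hδ b a hb fun l m => star (e l) * e m)) fun n => ?_
  rw [hS, hS, hS]
  exact hδ.cs _ _

end CSF

section Opn

lemma opnorm_csn {T : Type*} [NonUnitalRing T] [StarRing T] [Module ℂ T] [IsScalarTower ℂ T T]
    (X : Submodule ℂ T) (p : T → ℝ) (h0 : ∀ ξ, 0 ≤ p ξ)
    (hadd : ∀ ξ ∈ X, ∀ η ∈ X, p (ξ + η) ≤ p ξ + p η)
    (hsmul : ∀ c : ℂ, ∀ ξ ∈ X, p (c • ξ) ≤ ‖c‖ * p ξ)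
    (hX : ∀ t, ∀ ξ ∈ X, t * ξ ∈ X)
    (hbd : ∀ t, ∃ C : ℝ, 0 ≤ C ∧ ∀ ξ ∈ X, p (t * ξ) ≤ C * p ξ)
    (hst : ∀ t, ∀ ξ ∈ X, p (t * ξ) ^ 2 ≤ p ξ * p (star t * t * ξ)) :
    ∃ δ : T → ℝ, CSN δ ∧ ∀ t, ∀ ξ ∈ X, p (t * ξ) ≤ δ t * p ξ := by
  let S : T → Set ℝ := fun t => {C : ℝ | 0 ≤ C ∧ ∀ ξ ∈ X, p (t * ξ) ≤ C * p ξ}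
  have hSb : ∀ t, BddBelow (S t) := fun t => ⟨0, fun C hC => hC.1⟩
  have hmin : ∀ t C, 0 ≤ C → (∀ ξ ∈ X, p (t * ξ) ≤ C * p ξ) → sInf (S t) ≤ C :=
    fun t C h1 h2 => csInf_le (hSb t) ⟨h1, h2⟩
  have hnn : ∀ t, 0 ≤ sInf (S t) := fun t => Real.sInf_nonneg fun C hC => hC.1
  have hatt : ∀ t, ∀ ξ ∈ X, p (t * ξ) ≤ sInf (S t) * p ξ := by
    intro t ξ hξ
    rcases (h0 ξ).eq_or_lt with h | h
    · obtain ⟨C, hC, hC'⟩ := hbd t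
      have := hC' ξ hξ
      rw [← h] at this ⊢
      simpa using this
    · rw [← div_le_iff₀ h]
      refine le_csInf (hbd t) fun C hC => ?_
      rw [div_le_iff₀ h]
      exact hC.2 ξ hξ
  refine ⟨fun t => sInf (S t), ⟨hnn, ?_, ?_, ?_, ?_⟩, hatt⟩
  · intro x y
    refine hmin _ _ (add_nonneg (hnn x) (hnn y)) fun ξ hξ => ?_
    rw [add_mul, add_mul]
    exact (hadd _ (hX _ _ hξ) _ (hX _ _ hξ)).trans (add_le_add (hatt _ _ hξ) (hatt _ _ hξ))
  · intro c x
    refine hmin _ _ (mul_nonneg (norm_nonneg _) (hnn x)) fun ξ hξ => ?_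
    rw [smul_mul_assoc, mul_assoc]
    refine (hsmul _ _ (hX _ _ hξ)).trans ?_
    have := hatt x ξ hξ
    gcongr
  · intro x y
    refine hmin _ _ (mul_nonneg (hnn x) (hnn y)) fun ξ hξ => ?_
    rw [mul_assoc, mul_assoc]
    refine (hatt _ _ (hX _ _ hξ)).trans ?_
    have := hatt y ξ hξ
    have := hnn x
    gcongr
  · intro x
    have h1 : sInf (S x) ≤ √(sInf (S (star x * x))) := by
      refine hmin _ _ (Real.sqrt_nonneg _) fun ξ hξ => ?_
      refine abs_le_of_sq_le_sq' ?_ (mul_nonneg (Real.sqrt_nonneg _) (h0 ξ)) |>.2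
      rw [mul_pow, Real.sq_sqrt (hnn _)]
      have h2 := hatt (star x * x) ξ hξ
      have h3 := hst x ξ hξ
      nlinarith [mul_le_mul_of_nonneg_left h2 (h0 ξ)]
    exact (Real.le_sqrt (hnn _) (hnn _)).1 h1

end Opn

section Her
variable {A H B D : Type} [NonUnitalCStarAlgebra A] [NonUnitalCStarAlgebra H]
  [NonUnitalCStarAlgebra B] [NonUnitalCStarAlgebra D]

/-- action of the unitization by left multiplication -/
def uL (B : Type) [NonUnitalCStarAlgebra B] : Unitization ℂ B →ₗ[ℂ] B →ₗ[ℂ] B where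
  toFun m := m.fst • LinearMap.id + LinearMap.mulLeft ℂ m.snd
  map_add' m m' := by ext; simp [add_smul, add_mul]; abel
  map_smul' c m := by ext; simp [smul_smul, smul_mul_assoc]

lemma uL_apply (m : Unitization ℂ B) (b : B) : uL B m b = m.fst • b + m.snd * b := rfl

lemma uL_inr (b : B) : uL B (b : Unitization ℂ B) = LinearMap.mulLeft ℂ b := by
  ext; simp [uL_apply]

lemma uL_spec (m : Unitization ℂ B) (b : B) :
    ((uL B m b : B) : Unitization ℂ B) = m * (b : Unitization ℂ B) := by
  ext <;> simp [uL_apply]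

lemma uL_unitary {u : Unitization ℂ B} (hu : u ∈ unitary (Unitization ℂ B)) (a a' : B) :
    star (uL B u a) * uL B u a' = star a * a' := by
  apply Unitization.inr_injective (R := ℂ)
  rw [Unitization.inr_mul, Unitization.inr_star, uL_spec, uL_spec, star_mul,
        mul_assoc, ← mul_assoc (star u), Unitary.star_mul_self_of_mem hu, one_mul,
        Unitization.inr_mul, Unitization.inr_star]

lemma inner_map' (f : D →ₗ[ℂ] D) (hf : ∀ a a', star (f a) * f a' = star a * a')
    (x y : A ⊗[ℂ] D) :
    star (TensorProduct.map (LinearMap.id : A →ₗ[ℂ] A) f x) *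
      TensorProduct.map (LinearMap.id : A →ₗ[ℂ] A) f y = star x * y := by
  induction x using TensorProduct.induction_on with
  | zero => simp
  | add a b ha hb => rw [map_add, star_add, add_mul, star_add, add_mul, ha, hb]
  | tmul a d =>
    induction y using TensorProduct.induction_on with
    | zero => simp
    | add a b ha hb => rw [map_add, mul_add, mul_add, ha, hb]
    | tmul a' d' => simp [TensorProduct.star_tmul, hf]

/-- the left ideal `B H ⊗ D` -/
def herX (jH : H →⋆ₙₐ[ℂ] B) (D : Type) [NonUnitalCStarAlgebra D] : Submodule ℂ (B ⊗[ℂ] D) :=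
  Submodule.span ℂ {s | ∃ b h d, s = (b * jH h) ⊗ₜ[ℂ] d}

lemma herX_rep {jH : H →⋆ₙₐ[ℂ] B} {ξ : B ⊗[ℂ] D} (hξ : ξ ∈ herX jH D) :
    ∃ (ι : Type) (_ : Fintype ι) (b : ι → B) (h : ι → H) (d : ι → D),
      ξ = ∑ k, (b k * jH (h k)) ⊗ₜ[ℂ] d k := by
  induction hξ using Submodule.span_induction with
  | mem x hx =>
    obtain ⟨b, h, d, rfl⟩ := hx
    exact ⟨Unit, inferInstance, fun _ => b, fun _ => h, fun _ => d, by simp⟩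
  | zero => exact ⟨Empty, inferInstance, Empty.elim, Empty.elim, Empty.elim, by simp⟩
  | add x y _ _ hx hy =>
    obtain ⟨ι, _, b, h, d, rfl⟩ := hx
    obtain ⟨ι', _, b', h', d', rfl⟩ := hy
    exact ⟨ι ⊕ ι', inferInstance, Sum.elim b b', Sum.elim h h', Sum.elim d d', by simp⟩
  | smul c x _ hx =>
    obtain ⟨ι, _, b, h, d, rfl⟩ := hx
    exact ⟨ι, inferInstance, b, h, fun k => c • d k, by
      rw [Finset.smul_sum]; simp only [TensorProduct.tmul_smul]⟩

lemma herX_rep2 {jH : H →⋆ₙₐ[ℂ] B} {ξ η : B ⊗[ℂ] D} (hξ : ξ ∈ herX jH D) (hη : η ∈ herX jH D) :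
    ∃ (ι : Type) (_ : Fintype ι) (b : ι → B) (h : ι → H) (d e : ι → D),
      ξ = ∑ k, (b k * jH (h k)) ⊗ₜ[ℂ] d k ∧ η = ∑ k, (b k * jH (h k)) ⊗ₜ[ℂ] e k := by
  obtain ⟨ι, _, b, h, d, rfl⟩ := herX_rep hξ
  obtain ⟨ι', _, b', h', d', rfl⟩ := herX_rep hη
  exact ⟨ι ⊕ ι', inferInstance, Sum.elim b b', Sum.elim h h', Sum.elim d 0, Sum.elim 0 d',
    by simp, by simp⟩

/-- abbreviation for `jH ⊗ id` -/
abbrev tI (jH : H →⋆ₙₐ[ℂ] B) (D : Type) [NonUnitalCStarAlgebra D] : H ⊗[ℂ] D →ₗ[ℂ] B ⊗[ℂ] D :=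
  TensorProduct.map (jH : H →ₗ[ℂ] B) (LinearMap.id : D →ₗ[ℂ] D)

lemma herX_cs {jH : H →⋆ₙₐ[ℂ] B} (hj : Function.Injective jH)
    (her : ∀ h h' b, ∃ v, jH v = jH h * b * jH h') {δ : H ⊗[ℂ] D → ℝ} (hδ : CSN δ)
    {ξ η : B ⊗[ℂ] D} (hξ : ξ ∈ herX jH D) (hη : η ∈ herX jH D) :
    ∃ t u v, tI jH D t = star ξ * η ∧ tI jH D u = star ξ * ξ ∧ tI jH D v = star η * η ∧
      δ t ^ 2 ≤ δ u * δ v := by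
  obtain ⟨ι, _, b, h, d, e, rfl, rfl⟩ := herX_rep2 hξ hη
  have ha : ∀ l m, ∃ a, jH a = star (b l * jH (h l)) * (b m * jH (h m)) := by
    intro l m
    obtain ⟨v, hv⟩ := her (star (h l)) (h m) (star (b l) * b m)
    exact ⟨v, by rw [hv]; simp [map_star, mul_assoc]⟩
  choose a ha using ha
  have hx : ∀ c l m, ∃ v, jH v = star (b l * jH (h l)) * c * (b m * jH (h m)) := by
    intro c l m
    obtain ⟨v, hv⟩ := her (star (h l)) (h m) (star (b l) * c * b m)
    exact ⟨v, by rw [hv]; simp [map_star, mul_assoc]⟩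
  have key : ∀ d e : ι → D, tI jH D (∑ l, ∑ m, a l m ⊗ₜ[ℂ] (star (d l) * e m)) =
      star (∑ k, (b k * jH (h k)) ⊗ₜ[ℂ] d k) * ∑ k, (b k * jH (h k)) ⊗ₜ[ℂ] e k := by
    intro d e
    rw [star_sum, Finset.sum_mul_sum, map_sum]
    refine Finset.sum_congr rfl fun l _ => ?_
    rw [map_sum]
    refine Finset.sum_congr rfl fun m _ => ?_
    rw [TensorProduct.map_tmul, TensorProduct.star_tmul, Algebra.TensorProduct.tmul_mul_tmul, ← ha]
    rfl
  exact ⟨_, _, _, key d e, key d d, key e e, cs_fam hj (fun k => b k * jH (h k)) hx a ha hδ d e⟩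

lemma tI_inj {jH : H →⋆ₙₐ[ℂ] B} (hj : Function.Injective jH) : Function.Injective (tI jH D) :=
  Module.Flat.rTensor_preserves_injective_linearMap (jH : H →ₗ[ℂ] B) hj

lemma herX_mul {jH : H →⋆ₙₐ[ℂ] B} (t ξ : B ⊗[ℂ] D) (hξ : ξ ∈ herX jH D) : t * ξ ∈ herX jH D := by
  induction hξ using Submodule.span_induction with
  | zero => simp
  | add x y _ _ hx hy => rw [mul_add]; exact add_mem hx hy
  | smul c x _ hx => rw [mul_smul_comm]; exact Submodule.smul_mem _ _ hx
  | mem x hx =>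
    obtain ⟨b, h, d, rfl⟩ := hx
    induction t using TensorProduct.induction_on with
    | zero => simp
    | add x y hx hy => rw [add_mul]; exact add_mem hx hy
    | tmul b' d' =>
      rw [Algebra.TensorProduct.tmul_mul_tmul]
      exact Submodule.subset_span ⟨b' * b, h, d' * d, by rw [mul_assoc]⟩

lemma herX_l1 {jH : H →⋆ₙₐ[ℂ] B} (m : Unitization ℂ B) (ξ : B ⊗[ℂ] D) (hξ : ξ ∈ herX jH D) :
    TensorProduct.map (uL B m) (LinearMap.id : D →ₗ[ℂ] D) ξ ∈ herX jH D := by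
  induction hξ using Submodule.span_induction with
  | zero => simp
  | add x y _ _ hx hy => rw [map_add]; exact add_mem hx hy
  | smul c x _ hx => rw [map_smul]; exact Submodule.smul_mem _ _ hx
  | mem x hx =>
    obtain ⟨b, h, d, rfl⟩ := hx
    exact Submodule.subset_span ⟨uL B m b, h, d, by
      rw [TensorProduct.map_tmul, uL_apply, uL_apply, add_mul, mul_assoc, smul_mul_assoc]; rfl⟩

lemma herX_l2 {jH : H →⋆ₙₐ[ℂ] B} (m : Unitization ℂ D) (ξ : B ⊗[ℂ] D) (hξ : ξ ∈ herX jH D) :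
    TensorProduct.map (LinearMap.id : B →ₗ[ℂ] B) (uL D m) ξ ∈ herX jH D := by
  induction hξ using Submodule.span_induction with
  | zero => simp
  | add x y _ _ hx hy => rw [map_add]; exact add_mem hx hy
  | smul c x _ hx => rw [map_smul]; exact Submodule.smul_mem _ _ hx
  | mem x hx =>
    obtain ⟨b, h, d, rfl⟩ := hx
    exact Submodule.subset_span ⟨b, h, uL D m d, by
      rw [TensorProduct.map_tmul]; rfl⟩

lemma tmul_mul_eq (b : B) (d : D) (ξ : B ⊗[ℂ] D) : (b ⊗ₜ[ℂ] d) * ξ =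
    TensorProduct.map (LinearMap.mulLeft ℂ b) (LinearMap.id : D →ₗ[ℂ] D)
      (TensorProduct.map (LinearMap.id : B →ₗ[ℂ] B) (LinearMap.mulLeft ℂ d) ξ) := by
  induction ξ using TensorProduct.induction_on with
  | zero => simp
  | add x y hx hy => rw [mul_add, map_add, map_add, hx, hy]
  | tmul b' d' => simp

lemma her_csn {jH : H →⋆ₙₐ[ℂ] B} (hj : Function.Injective jH)
    (her : ∀ h h' b, ∃ v, jH v = jH h * b * jH h') {δ : H ⊗[ℂ] D → ℝ} (hδ : CSN δ) :
    ∃ δ' : B ⊗[ℂ] D → ℝ, CSN δ' ∧ ∀ (t s : H ⊗[ℂ] D), tI jH D s ∈ herX jH D →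
      δ (t * s) ≤ δ' (tI jH D t) * δ s := by
  have hi := tI_inj (D := D) hj
  let N : B ⊗[ℂ] D → ℝ := fun s => δ (Function.invFun (tI jH D) s)
  have hN : ∀ t, N (tI jH D t) = δ t := fun t => by
    simp only [N, Function.leftInverse_invFun hi t]
  let p : B ⊗[ℂ] D → ℝ := fun ξ => √(N (star ξ * ξ))
  have hp0 : ∀ ξ, 0 ≤ p ξ := fun ξ => Real.sqrt_nonneg _
  have hp2 : ∀ ξ, p ξ ^ 2 = N (star ξ * ξ) := fun ξ => Real.sq_sqrt (hδ.nonneg _)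
  have hcs : ∀ ξ ∈ herX jH D, ∀ η ∈ herX jH D, ∃ t, tI jH D t = star ξ * η ∧ δ t ≤ p ξ * p η := by
    intro ξ hξ η hη
    obtain ⟨t, u, v, ht, hu, hv, h⟩ := herX_cs hj her hδ hξ hη
    refine ⟨t, ht, abs_le_of_sq_le_sq' ?_ (mul_nonneg (hp0 _) (hp0 _)) |>.2⟩
    rwa [mul_pow, hp2, hp2, ← hu, ← hv, hN, hN]
  have hadd : ∀ ξ ∈ herX jH D, ∀ η ∈ herX jH D, p (ξ + η) ≤ p ξ + p η := by
    intro ξ hξ η hη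
    obtain ⟨t1, h1, h1'⟩ := hcs ξ hξ ξ hξ
    obtain ⟨t2, h2, h2'⟩ := hcs ξ hξ η hη
    obtain ⟨t3, h3, h3'⟩ := hcs η hη ξ hξ
    obtain ⟨t4, h4, h4'⟩ := hcs η hη η hη
    refine abs_le_of_sq_le_sq' ?_ (add_nonneg (hp0 _) (hp0 _)) |>.2
    have : star (ξ + η) * (ξ + η) = tI jH D (t1 + t2 + t3 + t4) := by
      simp only [map_add, h1, h2, h3, h4, star_add, add_mul, mul_add]; abel
    rw [hp2, this, hN]
    have a1 := hδ.add_le (t1 + t2 + t3) t4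
    have a2 := hδ.add_le (t1 + t2) t3
    have a3 := hδ.add_le t1 t2
    nlinarith
  have hsmul : ∀ c : ℂ, ∀ ξ ∈ herX jH D, p (c • ξ) ≤ ‖c‖ * p ξ := by
    intro c ξ hξ
    obtain ⟨t1, h1, h1'⟩ := hcs ξ hξ ξ hξ
    refine abs_le_of_sq_le_sq' ?_ (mul_nonneg (norm_nonneg _) (hp0 _)) |>.2
    have : star (c • ξ) * (c • ξ) = tI jH D ((star c * c) • t1) := by
      rw [map_smul, h1, star_smul, smul_mul_smul_comm]
    rw [hp2, this, hN, hδ.smul, norm_mul, norm_star]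
    nlinarith [mul_nonneg (norm_nonneg c) (norm_nonneg c)]
  have hpi : ∀ ξ η : B ⊗[ℂ] D, star ξ * ξ = star η * η → p ξ = p η := fun ξ η h => by
    simp only [p, h]
  have hbd : ∀ t, ∃ C : ℝ, 0 ≤ C ∧ ∀ ξ ∈ herX jH D, p (t * ξ) ≤ C * p ξ := by
    intro t
    induction t using TensorProduct.induction_on with
    | zero =>
      refine ⟨0, le_rfl, fun ξ _ => ?_⟩
      have := hsmul 0 0 (zero_mem _)
      simpa using this
    | add x y hx hy =>
      obtain ⟨C, hC, hx⟩ := hx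
      obtain ⟨C', hC', hy⟩ := hy
      refine ⟨C + C', by positivity, fun ξ hξ => ?_⟩
      rw [add_mul, add_mul]
      exact (hadd _ (herX_mul _ _ hξ) _ (herX_mul _ _ hξ)).trans (add_le_add (hx _ hξ) (hy _ hξ))
    | tmul b d =>
      refine ⟨2 * ‖b‖ * (2 * ‖d‖), by positivity, fun ξ hξ => ?_⟩
      have b1 : ∀ ξ ∈ herX jH D, p (TensorProduct.map (uL B (b : Unitization ℂ B))
          (LinearMap.id : D →ₗ[ℂ] D) ξ) ≤ 2 * ‖(b : Unitization ℂ B)‖ * p ξ := fun ξ hξ =>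
        unitary_bound (herX jH D) p hadd hsmul hp0
          ((LinearMap.rTensorHom D).comp (uL B)) (fun m v hv => herX_l1 m v hv)
          (fun u hu v hv => (hpi _ _ (inner_map (uL B u) (uL_unitary hu) v v)).le) _ ξ hξ
      have b2 : ∀ ξ ∈ herX jH D, p (TensorProduct.map (LinearMap.id : B →ₗ[ℂ] B)
          (uL D (d : Unitization ℂ D)) ξ) ≤ 2 * ‖(d : Unitization ℂ D)‖ * p ξ := fun ξ hξ =>
        unitary_bound (herX jH D) p hadd hsmul hp0
          ((LinearMap.lTensorHom B).comp (uL D)) (fun m v hv => herX_l2 m v hv)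
          (fun u hu v hv => (hpi _ _ (inner_map' (uL D u) (uL_unitary hu) v v)).le) _ ξ hξ
      rw [tmul_mul_eq, ← uL_inr, ← uL_inr]
      refine (b1 _ (herX_l2 _ _ hξ)).trans ?_
      have := b2 _ hξ
      rw [Unitization.norm_inr] at this ⊢
      rw [mul_assoc (2 * ‖b‖)]
      gcongr
  have hst : ∀ t, ∀ ξ ∈ herX jH D, p (t * ξ) ^ 2 ≤ p ξ * p (star t * t * ξ) := by
    intro t ξ hξ
    obtain ⟨t1, h1, h1'⟩ := hcs ξ hξ (star t * t * ξ) (herX_mul _ _ hξ)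
    have : star (t * ξ) * (t * ξ) = star ξ * (star t * t * ξ) := by
      rw [star_mul]; simp only [mul_assoc]
    rw [hp2, this, ← h1, hN]
    exact h1'
  obtain ⟨δ', hδ', h⟩ := opnorm_csn (herX jH D) p hp0 hadd hsmul herX_mul hbd hst
  have hps : ∀ s, p (tI jH D s) = δ s := by
    intro s
    simp only [p]
    rw [← map_star_star, ← map_star_mul, hN, hδ.cstar, Real.sqrt_sq (hδ.nonneg _)]
  refine ⟨δ', hδ', fun t s hs => ?_⟩
  have := h (tI jH D t) _ hs
  rwa [← map_star_mul, hps, hps] at this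

end Her

section Hered
variable {A H B D : Type} [NonUnitalCStarAlgebra A] [NonUnitalCStarAlgebra H]
  [NonUnitalCStarAlgebra B] [NonUnitalCStarAlgebra D]
open Filter Topology

lemma tendsto_sq {F : Filter H} (h1 : ∀ᶠ e in F, ‖e‖ ≤ 1)
    (h2 : ∀ a : H, Tendsto (fun e => a * e) F (𝓝 a)) (a : H) :
    Tendsto (fun e => a * (e * e)) F (𝓝 a) := by
  have h3 : Tendsto (fun e => a * e - a) F (𝓝 0) := by simpa using (h2 a).sub_const a
  have h4 : Tendsto (fun e => (a * e - a) * e) F (𝓝 0) := by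
    refine squeeze_zero_norm' ?_ (by simpa using h3.norm)
    filter_upwards [h1] with e he
    calc ‖(a * e - a) * e‖ ≤ ‖a * e - a‖ * ‖e‖ := norm_mul_le _ _
      _ ≤ ‖a * e - a‖ * 1 := by gcongr
      _ = _ := mul_one _
  have h5 := h4.add (h2 a)
  rw [zero_add] at h5
  refine h5.congr fun e => ?_
  rw [sub_mul, sub_add_cancel, mul_assoc]

lemma mul_tmul_eq (t : H ⊗[ℂ] D) (v : H) (e : D) : t * (v ⊗ₜ[ℂ] e) =
    TensorProduct.map (LinearMap.mulRight ℂ v) (LinearMap.id : D →ₗ[ℂ] D)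
      (TensorProduct.map (LinearMap.id : H →ₗ[ℂ] H) (LinearMap.mulRight ℂ e) t) := by
  induction t using TensorProduct.induction_on with
  | zero => simp
  | add x y hx hy => rw [add_mul, map_add, map_add, hx, hy]
  | tmul b' d' => simp

lemma map_comm' (f : D →ₗ[ℂ] D) (t : H ⊗[ℂ] D) :
    TensorProduct.comm ℂ D H (TensorProduct.map f (LinearMap.id : H →ₗ[ℂ] H)
      (TensorProduct.comm ℂ H D t)) = TensorProduct.map (LinearMap.id : H →ₗ[ℂ] H) f t := by
  induction t using TensorProduct.induction_on with
  | zero => simp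
  | add x y hx hy => simp only [map_add, hx, hy]
  | tmul b' d' => simp

lemma nuc_hered {jH : H →⋆ₙₐ[ℂ] B} (hj : Function.Injective jH)
    (her : ∀ h h' b, ∃ v, jH v = jH h * b * jH h') {ρ : A →ₗ[ℂ] H}
    (h : IsNuclearMap ((jH : H →ₗ[ℂ] B) ∘ₗ ρ)) : IsNuclearMap ρ := by
  obtain ⟨K, hK, h⟩ := h
  refine ⟨4 * K, by positivity, nb_iff.2 fun D _ γ δ hγ hγ0 hδ x => ?_⟩
  obtain ⟨δ', hδ', hb⟩ := her_csn (D := D) hj her hδ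
  set t := TensorProduct.map ρ (LinearMap.id : D →ₗ[ℂ] D) x with ht
  have h1 : δ' (tI jH D t) ≤ K * γ x := by
    have := nb_iff.1 h D γ δ' hγ hγ0 hδ' x
    rw [ht]
    simp only [tI, ← LinearMap.comp_apply, ← TensorProduct.map_comp, LinearMap.id_comp] at this ⊢
    exact this
  obtain ⟨F, hF, hF1, hF2, -⟩ := approx_unit H
  obtain ⟨G, hG, hG1, hG2, -⟩ := approx_unit D
  have step1 : ∀ e : D, ‖e‖ ≤ 1 →
      δ (TensorProduct.map (LinearMap.id : H →ₗ[ℂ] H) (LinearMap.mulRight ℂ e) t)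
        ≤ 4 * δ' (tI jH D t) := by
    intro e he
    have := tendsto_map_le hδ (F := F) (fun u => LinearMap.mulRight ℂ (u * u)) LinearMap.id
      (fun v => tendsto_sq hF1 hF2 v)
      (TensorProduct.map (LinearMap.id : H →ₗ[ℂ] H) (LinearMap.mulRight ℂ e) t)
      (4 * δ' (tI jH D t)) ?_
    · simpa using this
    · filter_upwards [hF1] with u hu
      rw [← mul_tmul_eq]
      refine (hb t _ ?_).trans ?_
      · refine Submodule.subset_span ⟨jH u, u, e, ?_⟩
        simp [tI]
      · have h2 := cross_bound hδ (u * u) e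
        have h3 : ‖u * u‖ ≤ 1 := (norm_mul_le _ _).trans (mul_le_one₀ hu (norm_nonneg _) hu)
        have h4 : δ ((u * u) ⊗ₜ[ℂ] e) ≤ 4 := by
          refine h2.trans ?_
          have := mul_le_one₀ h3 (norm_nonneg e) he
          nlinarith
        have := hδ'.nonneg (tI jH D t)
        nlinarith
  have step2 := tendsto_map_le (csn_comm hδ) (F := G) (fun e => LinearMap.mulRight ℂ e)
    LinearMap.id (fun v => by simpa using hG2 v) (TensorProduct.comm ℂ H D t)
      (4 * δ' (tI jH D t)) (by
        filter_upwards [hG1] with e he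
        rw [map_comm']
        exact step1 e he)
  rw [map_comm'] at step2
  simp only [TensorProduct.map_id, LinearMap.id_apply] at step2
  linarith

end Hered

section QA
variable {A B I E : Type} [NonUnitalCStarAlgebra A] [NonUnitalCStarAlgebra B]
  [NonUnitalCStarAlgebra I] [NonUnitalCStarAlgebra E]
open Filter Topology

def idealR0 (j : I →⋆ₙₐ[ℂ] E) (hj : IsIdealEmbedding j) (e : E) (b : I) : I :=
  (hj.mul_mem_right e b).choose

lemma idealR0_spec (j : I →⋆ₙₐ[ℂ] E) (hj : IsIdealEmbedding j) (e : E) (b : I) :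
    j (idealR0 j hj e b) = j b * e := (hj.mul_mem_right e b).choose_spec

def idealR (j : I →⋆ₙₐ[ℂ] E) (hj : IsIdealEmbedding j) (e : E) : I →ₗ[ℂ] I where
  toFun b := idealR0 j hj e b
  map_add' x y := hj.inj (by simp only [map_add, idealR0_spec, add_mul])
  map_smul' c x := hj.inj (by
    simp only [RingHom.id_apply, map_smul, idealR0_spec, smul_mul_assoc])

lemma idealR_spec (j : I →⋆ₙₐ[ℂ] E) (hj : IsIdealEmbedding j) (e : E) (b : I) :
    j (idealR j hj e b) = j b * e := (hj.mul_mem_right e b).choose_spec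

lemma hom_isometry {j : I →⋆ₙₐ[ℂ] E} (hj : Function.Injective j) : Isometry j :=
  AddMonoidHomClass.isometry_of_norm j fun x => NonUnitalStarAlgHom.norm_map j hj x

lemma nucSub_right {j : I →⋆ₙₐ[ℂ] E} {hj : IsIdealEmbedding j}
    {φ : A →⋆ₙₐ[ℂ] E} {ψ : I →⋆ₙₐ[ℂ] B} {y y' : I} (hy : y ∈ nucSub j hj φ ψ) (e : E)
    (h : j y' = j y * e) : y' ∈ nucSub j hj φ ψ := by
  rw [mem_nucSub] at hy ⊢
  have := nuc_right hj ψ (idealR_spec j hj e) hy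
  convert this using 2
  ext x
  apply hj.inj
  simp only [LinearMap.comp_apply]
  rw [actL_spec, idealR_spec, actL_spec, h, mul_assoc]

lemma nucSub_left {j : I →⋆ₙₐ[ℂ] E} {hj : IsIdealEmbedding j}
    {φ : A →⋆ₙₐ[ℂ] E} {ψ : I →⋆ₙₐ[ℂ] B} {y y' : I} (hy : y ∈ nucSub j hj φ ψ) (a : A)
    (h : j y' = φ a * j y) : y' ∈ nucSub j hj φ ψ := by
  rw [mem_nucSub] at hy ⊢
  have := nuc_pre a hy
  rw [LinearMap.comp_assoc] at this
  convert this using 2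
  ext x
  apply hj.inj
  simp only [LinearMap.comp_apply, LinearMap.mulRight_apply]
  rw [actL_spec, actL_spec, h, map_mul, mul_assoc]

lemma free_gen {Q : Type} [NonUnitalCStarAlgebra Q] (P : QPresentation A Q)
    (S : NonUnitalStarSubalgebra ℂ Q) (hS : IsClosed (S : Set Q))
    (h1 : ∀ x, P.ι x ∈ S) (h2 : ∀ x, P.ιbar x ∈ S) (z : Q) : z ∈ S := by
  have := hS
  let _ : NonUnitalCStarAlgebra S := NonUnitalStarSubalgebra.nonUnitalCStarAlgebra S
  obtain ⟨h, ⟨hh1, hh2⟩, -⟩ := P.free S (NonUnitalStarAlgHom.codRestrict P.ι S h1)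
    (NonUnitalStarAlgHom.codRestrict P.ιbar S h2)
  obtain ⟨k, -, hk⟩ := P.free Q P.ι P.ιbar
  have e1 := hk ((NonUnitalStarSubalgebraClass.subtype S).comp h) ⟨by
    rw [NonUnitalStarAlgHom.comp_assoc, hh1]; rfl, by
    rw [NonUnitalStarAlgHom.comp_assoc, hh2]; rfl⟩
  have e2 := hk (NonUnitalStarAlgHom.id ℂ Q) ⟨rfl, rfl⟩
  have e3 := DFunLike.congr_fun (e1.trans e2.symm) z
  have : ((h z : S) : Q) = z := e3
  rw [← this]; exact (h z).2

variable {QA qA : Type} [NonUnitalCStarAlgebra QA] [NonUnitalCStarAlgebra qA]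

lemma q_ideal {π : QA →⋆ₙₐ[ℂ] A} {j : qA →⋆ₙₐ[ℂ] QA} (hj : Function.Injective j)
    (hr : Set.range j = {z : QA | π z = 0}) : IsIdealEmbedding j where
  inj := hj
  closed := by rw [hr]; exact isClosed_eq (hom_cont π) continuous_const
  mul_mem_left e b := by
    have h1 : π (j b) = 0 := (hr ▸ Set.mem_range_self b : j b ∈ {z : QA | π z = 0})
    have : e * j b ∈ Set.range j := by rw [hr]; show π _ = 0; rw [map_mul, h1, mul_zero]
    exact this
  mul_mem_right e b := by
    have h1 : π (j b) = 0 := (hr ▸ Set.mem_range_self b : j b ∈ {z : QA | π z = 0})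
    have : j b * e ∈ Set.range j := by rw [hr]; show π _ = 0; rw [map_mul, h1, zero_mul]
    exact this

/-- the linear map `x ↦ qx` -/
def qeL (P : QPresentation A QA) {j : qA →⋆ₙₐ[ℂ] QA} (hj : Function.Injective j)
    (qe : A → qA) (hqe : ∀ x : A, j (qe x) = P.ι x - P.ιbar x) : A →ₗ[ℂ] qA where
  toFun := qe
  map_add' x y := hj (by simp only [map_add, hqe]; abel)
  map_smul' c x := hj (by simp only [map_smul, hqe, RingHom.id_apply, smul_sub])

lemma i_ii (P : QPresentation A QA) {π : QA →⋆ₙₐ[ℂ] A}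
    (hπ : ∀ x, π (P.ι x) = x) (hπ' : ∀ x, π (P.ιbar x) = x)
    {j : qA →⋆ₙₐ[ℂ] QA} (hj : Function.Injective j)
    (hr : Set.range j = {z : QA | π z = 0})
    (qe : A → qA) (hqe : ∀ x : A, j (qe x) = P.ι x - P.ιbar x)
    (ψ : qA →⋆ₙₐ[ℂ] B) (h : IsNuclearMap ((ψ : qA →ₗ[ℂ] B) ∘ₗ qeL P hj qe hqe)) (y : qA) :
    y ∈ nucSub j (q_ideal hj hr) P.ι ψ := by
  set hI := q_ideal hj hr
  set N := nucSub j hI P.ι ψ with hN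
  have hq : ∀ a, qe a ∈ N := by
    intro a
    rw [hN, mem_nucSub]
    have := nuc_sub (nuc_pre a h) (nuc_right hI ψ (idealR_spec j hI (P.ιbar a)) h)
    rw [LinearMap.comp_assoc, ← LinearMap.comp_sub] at this
    have e : actL j hI P.ι (qe a) = qeL P hj qe hqe ∘ₗ LinearMap.mulRight ℂ a -
        idealR j hI (P.ιbar a) ∘ₗ qeL P hj qe hqe := by
      ext x
      apply hj
      simp only [LinearMap.sub_apply, LinearMap.comp_apply, LinearMap.mulRight_apply, qeL,
        LinearMap.coe_mk, AddHom.coe_mk]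
      rw [actL_spec, map_sub, idealR_spec, hqe, hqe, hqe, map_mul, map_mul]
      simp only [mul_sub, sub_mul]; abel
    rw [e]; exact this
  let M : Submodule ℂ QA := (N.map (j : qA →ₗ[ℂ] QA)).comap
    (LinearMap.id - (P.ι : A →ₗ[ℂ] QA) ∘ₗ (π : QA →ₗ[ℂ] A))
  have hM : ∀ z, z ∈ M ↔ ∃ y ∈ N, j y = z - P.ι (π z) := fun z => Iff.rfl
  have hMc : IsClosed (M : Set QA) := by
    have h1 : IsClosed (j '' (N : Set qA)) :=
      (hom_isometry hj).isClosedEmbedding.isClosedMap _ (nucSub_closed j hI P.ι ψ)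
    have h2 : Continuous fun z => z - P.ι (π z) :=
      continuous_id.sub ((hom_cont P.ι).comp (hom_cont π))
    exact h1.preimage h2
  have hMmul : ∀ z ∈ M, ∀ w ∈ M, z * w ∈ M := by
    intro z hz w hw
    rw [hM] at hz hw ⊢
    obtain ⟨u, hu, hz⟩ := hz
    obtain ⟨v, hv, hw⟩ := hw
    refine ⟨idealR j hI w u + idealL j hI (P.ι (π z)) v, N.add_mem
      (nucSub_right hu w (idealR_spec _ _ _ _)) (nucSub_left hv (π z) (idealL_spec _ _ _ _)), ?_⟩
    rw [map_add, idealR_spec, idealL_spec, hz, hw, map_mul, map_mul]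
    simp only [mul_sub, sub_mul]; abel
  let S : NonUnitalStarSubalgebra ℂ QA :=
    { carrier := {z | z ∈ M ∧ star z ∈ M}
      zero_mem' := ⟨M.zero_mem, by rw [star_zero]; exact M.zero_mem⟩
      add_mem' := fun {a b} ha hb => ⟨M.add_mem ha.1 hb.1, by
        rw [star_add]; exact M.add_mem ha.2 hb.2⟩
      smul_mem' := fun c a ha => ⟨M.smul_mem c ha.1, by
        rw [star_smul]; exact M.smul_mem _ ha.2⟩
      mul_mem' := fun {a b} ha hb => ⟨hMmul _ ha.1 _ hb.1, by
        rw [star_mul]; exact hMmul _ hb.2 _ ha.2⟩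
      star_mem' := fun {a} ha => ⟨ha.2, by rw [star_star]; exact ha.1⟩ }
  have hS : IsClosed (S : Set QA) := hMc.inter (hMc.preimage continuous_star)
  have m1 : ∀ x, P.ι x ∈ M := fun x => (hM _).2 ⟨0, N.zero_mem, by rw [hπ, map_zero, sub_self]⟩
  have m2 : ∀ x, P.ιbar x ∈ M := fun x => (hM _).2 ⟨-qe x, N.neg_mem (hq x), by
    rw [hπ', map_neg, hqe, neg_sub]⟩
  have hz := free_gen P S hS (fun x => ⟨m1 x, by rw [← map_star]; exact m1 _⟩)
    (fun x => ⟨m2 x, by rw [← map_star]; exact m2 _⟩) (j y)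
  obtain ⟨y', hy', e⟩ := (hM _).1 hz.1
  have h1 : π (j y) = 0 := (hr ▸ Set.mem_range_self y : j y ∈ {z : QA | π z = 0})
  rw [h1, map_zero, sub_zero] at e
  rwa [← hj e]

lemma actL_sub (P : QPresentation A QA) {j : qA →⋆ₙₐ[ℂ] QA} (hI : IsIdealEmbedding j)
    (qe : A → qA) (hqe : ∀ x : A, j (qe x) = P.ι x - P.ιbar x)
    (ψ : qA →⋆ₙₐ[ℂ] B) (y : qA) :
    LinearMap.mulRight ℂ (ψ y) ∘ₗ (ψ : qA →ₗ[ℂ] B) ∘ₗ qeL P hI.inj qe hqe =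
    (ψ : qA →ₗ[ℂ] B) ∘ₗ actL j hI P.ι y - (ψ : qA →ₗ[ℂ] B) ∘ₗ actL j hI P.ιbar y := by
  rw [← LinearMap.comp_sub]
  ext x
  show ψ (qe x) * ψ y = ψ (actL j hI P.ι y x - actL j hI P.ιbar y x)
  rw [← map_mul]
  congr 1
  apply hI.inj
  rw [map_mul, map_sub, actL_spec, actL_spec, hqe, sub_mul]

lemma i_ii' (P : QPresentation A QA) {π : QA →⋆ₙₐ[ℂ] A}
    (hπ : ∀ x, π (P.ι x) = x) (hπ' : ∀ x, π (P.ιbar x) = x)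
    {j : qA →⋆ₙₐ[ℂ] QA} (hj : Function.Injective j)
    (hr : Set.range j = {z : QA | π z = 0})
    (qe : A → qA) (hqe : ∀ x : A, j (qe x) = P.ι x - P.ιbar x)
    (ψ : qA →⋆ₙₐ[ℂ] B) (h : IsNuclearMap ((ψ : qA →ₗ[ℂ] B) ∘ₗ qeL P hj qe hqe)) (y : qA) :
    y ∈ nucSub j (q_ideal hj hr) P.ιbar ψ := by
  rw [mem_nucSub]
  have h1 := i_ii P hπ hπ' hj hr qe hqe ψ h y
  rw [mem_nucSub] at h1
  have h2 := nuc_mulRight (ψ y) h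
  have h3 := actL_sub P (q_ideal hj hr) qe hqe ψ y
  rw [h3] at h2
  have := nuc_sub h1 h2
  rwa [sub_sub_cancel] at this

lemma ii_i (P : QPresentation A QA) {j : qA →⋆ₙₐ[ℂ] QA} (hI : IsIdealEmbedding j)
    (qe : A → qA) (hqe : ∀ x : A, j (qe x) = P.ι x - P.ιbar x)
    (ψ : qA →⋆ₙₐ[ℂ] B) (h1 : ∀ y, y ∈ nucSub j hI P.ι ψ) (h2 : ∀ y, y ∈ nucSub j hI P.ιbar ψ) :
    IsNuclearMap ((ψ : qA →ₗ[ℂ] B) ∘ₗ qeL P hI.inj qe hqe) := by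
  obtain ⟨F, hF, hF1, hF2, -⟩ := approx_unit qA
  refine ⟨4, by norm_num, nb_of_tendsto (F := F) (fun e => LinearMap.mulRight ℂ (ψ e) ∘ₗ
    (ψ : qA →ₗ[ℂ] B) ∘ₗ qeL P hI.inj qe hqe) _ (fun v => ?_) _ ?_⟩
  · have := ((hom_cont ψ).tendsto _).comp (hF2 (qe v))
    refine this.congr fun e => ?_
    show ψ (qe v * e) = ψ (qe v) * ψ e
    rw [map_mul]
  · filter_upwards [hF1] with e he
    rw [actL_sub P hI qe hqe ψ e]
    have k1 := key_bound (mem_nucSub.1 (h1 e))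
    have k2 := key_bound (mem_nucSub.1 (h2 e))
    refine nb_iff.2 fun D _ γ δ hγ hγ0 hδ x => ?_
    have k1 := nb_iff.1 k1 D γ δ hγ hγ0 hδ x
    have k2 := nb_iff.1 k2 D γ δ hγ hγ0 hδ x
    show δ (LinearMap.rTensor D (_ - _) x) ≤ _
    rw [LinearMap.rTensor_sub, LinearMap.sub_apply]
    refine (hδ.sub_le _ _).trans ((add_le_add k1 k2).trans ?_)
    have := hγ.nonneg x
    nlinarith

end QA

section Mult
variable {A B H QA qA : Type} [NonUnitalCStarAlgebra A] [NonUnitalCStarAlgebra B]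
  [NonUnitalCStarAlgebra H] [NonUnitalCStarAlgebra QA] [NonUnitalCStarAlgebra qA]
open Filter Topology
open scoped MultiplierAlgebra

/-- the inclusion into multipliers -/
def cM (H : Type) [NonUnitalCStarAlgebra H] : H →⋆ₙₐ[ℂ] 𝓜(ℂ, H) := DoubleCentralizer.coeHom

lemma cM_apply (u : H) : cM H u = (u : 𝓜(ℂ, H)) := rfl

lemma eq_of_mul_left {a b : H} (h : ∀ z : H, z * a = z * b) : a = b := by
  have h1 : star (a - b) * (a - b) = 0 := by rw [mul_sub, h, sub_self]
  rw [CStarRing.star_mul_self_eq_zero_iff] at h1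
  exact sub_eq_zero.1 h1

lemma cM_left (m : 𝓜(ℂ, H)) (b : H) : cM H (m.fst b) = m * cM H b := by
  refine DoubleCentralizer.ext ℂ H _ _ (Prod.ext ?_ ?_)
  · ext x
    show m.fst b * x = m.fst (b * x)
    refine eq_of_mul_left fun z => ?_
    rw [← mul_assoc, ← m.central, ← m.central, mul_assoc]
  · ext x
    show x * m.fst b = m.snd x * b
    rw [m.central]

lemma cM_ideal (H : Type) [NonUnitalCStarAlgebra H] : IsIdealEmbedding (cM H) := by
  have hinj : Function.Injective (cM H) := by
    intro a b hab
    refine eq_of_mul_left fun z => ?_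
    exact congrArg (fun m : 𝓜(ℂ, H) => m.snd z) hab
  refine ⟨hinj, (hom_isometry hinj).isClosedEmbedding.isClosed_range,
    fun e b => ⟨_, cM_left e b⟩, fun e b => ⟨star ((star e).fst (star b)), ?_⟩⟩
  rw [map_star, cM_left, star_mul, star_star, map_star, star_star]

lemma psi_range {ψ : qA →⋆ₙₐ[ℂ] B} {jH : H →⋆ₙₐ[ℂ] B}
    (hrH : Set.range jH = closure ((Submodule.span ℂ
      {x : B | ∃ z w : qA, ∃ b : B, x = ψ z * b * ψ w} : Submodule ℂ B) : Set B)) (z : qA) :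
    ∃ u, jH u = ψ z := by
  obtain ⟨F, hF, hF1, hF2, -⟩ := approx_unit qA
  have h : ψ z ∈ Set.range jH := by
    rw [hrH]
    refine mem_closure_of_tendsto (((hom_cont ψ).tendsto _).comp (tendsto_sq hF1 hF2 z))
      (Eventually.of_forall fun e => Submodule.subset_span ⟨z, e, ψ e, ?_⟩)
    simp [mul_assoc]
  exact h

lemma psi_her {ψ : qA →⋆ₙₐ[ℂ] B} {jH : H →⋆ₙₐ[ℂ] B}
    (hrH : Set.range jH = closure ((Submodule.span ℂ
      {x : B | ∃ z w : qA, ∃ b : B, x = ψ z * b * ψ w} : Submodule ℂ B) : Set B)) (h h' : H) (b : B) :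
    ∃ v, jH v = jH h * b * jH h' := by
  set T := Submodule.span ℂ {x : B | ∃ z w : qA, ∃ b : B, x = ψ z * b * ψ w} with hT
  set C := T.topologicalClosure with hC
  have hCc : IsClosed (C : Set B) := T.isClosed_topologicalClosure
  have hmem : ∀ x, x ∈ C ↔ ∃ v, jH v = x := by
    intro x
    show x ∈ closure (T : Set B) ↔ x ∈ Set.range jH
    rw [hrH]
  have h1 : ∀ x ∈ {x : B | ∃ z w : qA, ∃ b : B, x = ψ z * b * ψ w}, ∀ y ∈ C, x * b * y ∈ C := by
    rintro x ⟨z, w, c, rfl⟩ y hy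
    have : C ≤ C.comap (LinearMap.mulLeft ℂ (ψ z * c * ψ w * b)) := by
      refine T.topologicalClosure_minimal (Submodule.span_le.2 ?_)
        (hCc.preimage (continuous_const_mul _))
      rintro y ⟨z', w', c', rfl⟩
      refine T.le_topologicalClosure (Submodule.subset_span ⟨z, w', c * ψ w * b * ψ z' * c', ?_⟩)
      simp [mul_assoc]
    exact this hy
  have h2 : ∀ x ∈ C, ∀ y ∈ C, x * b * y ∈ C := by
    intro x hx y hy
    have : C ≤ C.comap (LinearMap.mulRight ℂ (b * y)) := by
      refine T.topologicalClosure_minimal (Submodule.span_le.2 ?_)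
        (hCc.preimage (continuous_mul_const _))
      intro x hx
      have := h1 x hx y hy
      rw [mul_assoc] at this
      exact this
    have := this hx
    rw [mul_assoc]; exact this
  exact (hmem _).1 (h2 _ ((hmem _).2 ⟨h, rfl⟩) _ ((hmem _).2 ⟨h', rfl⟩))

lemma ii_iv {j : qA →⋆ₙₐ[ℂ] QA} (hI : IsIdealEmbedding j) {ψ : qA →⋆ₙₐ[ℂ] B}
    {jH : H →⋆ₙₐ[ℂ] B} (hjH : Function.Injective jH)
    (hrH : Set.range jH = closure ((Submodule.span ℂ
      {x : B | ∃ z w : qA, ∃ b : B, x = ψ z * b * ψ w} : Submodule ℂ B) : Set B))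
    {E : Type} [NonUnitalCStarAlgebra E] {c : H →⋆ₙₐ[ℂ] E} (hc : IsIdealEmbedding c)
    (ψext : QA →⋆ₙₐ[ℂ] E)
    (hψext : ∀ (z : qA) (u : H), jH u = ψ z → ψext (j z) = c u)
    (k : A →⋆ₙₐ[ℂ] QA) (h : ∀ y, y ∈ nucSub j hI k ψ) (u : H) :
    IsNuclearMap (actL c hc (ψext.comp k) u) := by
  choose hz hhz using psi_range hrH
  set N := nucSub c hc (ψext.comp k) (NonUnitalStarAlgHom.id ℂ H) with hN
  have hNc : IsClosed (N : Set H) := nucSub_closed _ _ _ _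
  have h1 : ∀ z v, hz z * v ∈ N := by
    intro z v
    rw [hN, mem_nucSub]
    refine nuc_hered hjH (psi_her hrH) ?_
    have := nuc_mulRight (jH v) (mem_nucSub.1 (h z))
    have e : (jH : H →ₗ[ℂ] B) ∘ₗ ((NonUnitalStarAlgHom.id ℂ H : H →⋆ₙₐ[ℂ] H) : H →ₗ[ℂ] H) ∘ₗ
        actL c hc (ψext.comp k) (hz z * v) =
        LinearMap.mulRight ℂ (jH v) ∘ₗ (ψ : qA →ₗ[ℂ] B) ∘ₗ actL j hI k z := by
      ext x
      show jH (actL c hc (ψext.comp k) (hz z * v) x) = ψ (actL j hI k z x) * jH v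
      rw [← hhz, ← map_mul]
      congr 1
      apply hc.inj
      rw [actL_spec, map_mul, map_mul, ← hψext _ _ (hhz z),
        ← hψext _ _ (hhz (actL j hI k z x)), actL_spec, map_mul, mul_assoc]
      rfl
    rw [e]; exact this
  have h2 : ∀ x ∈ {x : B | ∃ z w : qA, ∃ b : B, x = ψ z * b * ψ w},
      x ∈ N.map (jH : H →ₗ[ℂ] B) := by
    rintro x ⟨z, w, b, rfl⟩
    have : ψ z * b * ψ w ∈ Set.range jH := by
      rw [hrH]; exact subset_closure (Submodule.subset_span ⟨z, w, b, rfl⟩)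
    obtain ⟨v, hv⟩ := this
    refine ⟨v, ?_, hv⟩
    obtain ⟨F, hF, hF1, -, hF2⟩ := approx_unit qA
    refine hNc.mem_of_tendsto (f := fun e => hz e * v) (b := F) ?_
      (Eventually.of_forall fun e => h1 e v)
    rw [(hom_isometry hjH).isEmbedding.tendsto_nhds_iff, hv]
    have := (((hom_cont ψ).tendsto _).comp (hF2 z)).mul_const (b * ψ w)
    rw [← mul_assoc] at this
    refine this.congr fun e => ?_
    simp [hhz, hv, mul_assoc]
  have hcl : IsClosed ((N.map (jH : H →ₗ[ℂ] B) : Submodule ℂ B) : Set B) :=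
    (hom_isometry hjH).isClosedEmbedding.isClosedMap _ hNc
  have h3 : jH u ∈ N.map (jH : H →ₗ[ℂ] B) := by
    have : jH u ∈ Set.range jH := ⟨u, rfl⟩
    rw [hrH] at this
    exact closure_minimal (Submodule.span_le.2 h2) hcl this
  obtain ⟨u', hu', e⟩ := h3
  have e2 : u' = u := hjH e
  rw [e2] at hu'
  have h4 := mem_nucSub.1 hu'
  have e3 : ((NonUnitalStarAlgHom.id ℂ H : H →⋆ₙₐ[ℂ] H) : H →ₗ[ℂ] H) ∘ₗ
      actL c hc (ψext.comp k) u = actL c hc (ψext.comp k) u := LinearMap.ext fun x => rfl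
  rw [e3] at h4
  exact h4

lemma iii_ii {P : QPresentation A QA} {j : qA →⋆ₙₐ[ℂ] QA} {hI : IsIdealEmbedding j}
    {ψ : qA →⋆ₙₐ[ℂ] B} {E J : Type} [NonUnitalCStarAlgebra E] [NonUnitalCStarAlgebra J]
    (W : QNuclearWitness A QA qA B P j ψ E J) (k : A →⋆ₙₐ[ℂ] QA)
    (hk : ∀ (u : J) (ρ : A →ₗ[ℂ] J), (∀ x, W.jJE (ρ x) = W.Θ (k x) * W.jJE u) → IsNuclearMap ρ)
    (y : qA) : y ∈ nucSub j hI k ψ := by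
  obtain ⟨u, hu, hu'⟩ := W.hrep y
  have h1 := hk u (actL W.jJE W.hJE (W.Θ.comp k) u) (fun x => actL_spec _ _ _ _ _)
  have h2 := nuc_comp W.jJB h1
  rw [mem_nucSub]
  have e : (ψ : qA →ₗ[ℂ] B) ∘ₗ actL j hI k y =
      (W.jJB : J →ₗ[ℂ] B) ∘ₗ actL W.jJE W.hJE (W.Θ.comp k) u := by
    ext x
    show ψ (actL j hI k y x) = W.jJB (actL W.jJE W.hJE (W.Θ.comp k) u x)
    obtain ⟨v, hv, hv'⟩ := W.hrep (actL j hI k y x)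
    rw [hv']
    congr 1
    apply W.hJE.inj
    rw [hv, actL_spec, actL_spec, hu, map_mul]; rfl
  rw [e]; exact h2

lemma act_iff {j : qA →⋆ₙₐ[ℂ] QA} (hI : IsIdealEmbedding j) (ψ : qA →⋆ₙₐ[ℂ] B)
    (k : A →⋆ₙₐ[ℂ] QA) (y : qA) :
    (∀ ρ : A →ₗ[ℂ] B, (∀ (x : A) (w : qA), j w = k x * j y → ρ x = ψ w) → IsNuclearMap ρ) ↔
      y ∈ nucSub j hI k ψ := by
  rw [mem_nucSub]
  constructor
  · intro h
    refine h _ fun x w hw => ?_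
    show ψ (actL j hI k y x) = ψ w
    congr 1
    apply hI.inj
    rw [actL_spec, hw]
  · intro h ρ hρ
    have : ρ = (ψ : qA →ₗ[ℂ] B) ∘ₗ actL j hI k y := by
      ext x
      exact hρ x _ (actL_spec _ _ _ _ _)
    rw [this]; exact h

end Mult

open scoped MultiplierAlgebra in
theorem statement15 (A QA qA B : Type)
    [NonUnitalCStarAlgebra A] [NonUnitalCStarAlgebra QA] [NonUnitalCStarAlgebra qA]
    [NonUnitalCStarAlgebra B]
    (P : QPresentation A QA) (π : QA →⋆ₙₐ[ℂ] A)
    (hπ : ∀ x, π (P.ι x) = x) (hπ' : ∀ x, π (P.ιbar x) = x)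
    (j : qA →⋆ₙₐ[ℂ] QA) (hj : Function.Injective j)
    (hr : Set.range j = {z : QA | π z = 0})
    (qe : A → qA) (hqe : ∀ x : A, j (qe x) = P.ι x - P.ιbar x)
    (ψ : qA →⋆ₙₐ[ℂ] B)
    -- the hereditary subalgebra `H = h(ψ(qA)) ⊆ B` generated by `ψ(qA)` ...
    (HT : Type) [NonUnitalCStarAlgebra HT]
    (jH : HT →⋆ₙₐ[ℂ] B) (hjH : Function.Injective jH)
    (hrH : Set.range jH = closure ((Submodule.span ℂ
      {x : B | ∃ z w : qA, ∃ b : B, x = ψ z * b * ψ w} : Submodule ℂ B) : Set B))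
    -- ... and the canonical extension `ψ° : QA → 𝓜(H)` of `ψ`
    (ψext : QA →⋆ₙₐ[ℂ] 𝓜(ℂ, HT))
    (hψext : ∀ (z : qA) (u : HT), jH u = ψ z → ψext (j z) = (u : 𝓜(ℂ, HT))) :
    -- (i) ↔ (ii)
    ((∀ ρ : A →ₗ[ℂ] B, (∀ x, ρ x = ψ (qe x)) → IsNuclearMap ρ) ↔
      (∀ y : qA,
        (∀ ρ : A →ₗ[ℂ] B, (∀ (x : A) (w : qA), j w = P.ι x * j y → ρ x = ψ w) →
          IsNuclearMap ρ) ∧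
        (∀ ρ : A →ₗ[ℂ] B, (∀ (x : A) (w : qA), j w = P.ιbar x * j y → ρ x = ψ w) →
          IsNuclearMap ρ))) ∧
    -- (ii) ↔ (iii)
    ((∀ y : qA,
        (∀ ρ : A →ₗ[ℂ] B, (∀ (x : A) (w : qA), j w = P.ι x * j y → ρ x = ψ w) →
          IsNuclearMap ρ) ∧
        (∀ ρ : A →ₗ[ℂ] B, (∀ (x : A) (w : qA), j w = P.ιbar x * j y → ρ x = ψ w) →
          IsNuclearMap ρ)) ↔
      (∃ (E : Type) (iE : NonUnitalCStarAlgebra E) (J : Type) (iJ : NonUnitalCStarAlgebra J),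
        Nonempty (@QNuclearWitness A QA qA B _ _ _ _ P j ψ E J iE iJ))) ∧
    -- (iii) ↔ (iv)
    ((∃ (E : Type) (iE : NonUnitalCStarAlgebra E) (J : Type) (iJ : NonUnitalCStarAlgebra J),
        Nonempty (@QNuclearWitness A QA qA B _ _ _ _ P j ψ E J iE iJ)) ↔
      ((∀ (u : HT) (ρ : A →ₗ[ℂ] HT),
          (∀ x : A, ((ρ x : HT) : 𝓜(ℂ, HT)) = ψext (P.ι x) * ((u : HT) : 𝓜(ℂ, HT))) →
          IsNuclearMap ρ) ∧
       (∀ (u : HT) (ρ : A →ₗ[ℂ] HT),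
          (∀ x : A, ((ρ x : HT) : 𝓜(ℂ, HT)) = ψext (P.ιbar x) * ((u : HT) : 𝓜(ℂ, HT))) →
          IsNuclearMap ρ))) := by
  have hI := q_ideal hj hr
  have hrg := psi_range hrH
  have i_ii_iff : (∀ ρ : A →ₗ[ℂ] B, (∀ x, ρ x = ψ (qe x)) → IsNuclearMap ρ) ↔
      IsNuclearMap ((ψ : qA →ₗ[ℂ] B) ∘ₗ qeL P hj qe hqe) := by
    constructor
    · intro h; exact h _ fun x => rfl
    · intro h ρ hρ
      have : ρ = (ψ : qA →ₗ[ℂ] B) ∘ₗ qeL P hj qe hqe := LinearMap.ext hρ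
      rw [this]; exact h
  have ii_iff : (∀ y : qA,
        (∀ ρ : A →ₗ[ℂ] B, (∀ (x : A) (w : qA), j w = P.ι x * j y → ρ x = ψ w) →
          IsNuclearMap ρ) ∧
        (∀ ρ : A →ₗ[ℂ] B, (∀ (x : A) (w : qA), j w = P.ιbar x * j y → ρ x = ψ w) →
          IsNuclearMap ρ)) ↔
      ((∀ y, y ∈ nucSub j hI P.ι ψ) ∧ (∀ y, y ∈ nucSub j hI P.ιbar ψ)) := by
    rw [← forall_and]
    exact forall_congr' fun y => and_congr (act_iff hI ψ P.ι y) (act_iff hI ψ P.ιbar y)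
  have hwn : ∀ k : A →⋆ₙₐ[ℂ] QA, (∀ y, y ∈ nucSub j hI k ψ) → ∀ (u : HT) (ρ : A →ₗ[ℂ] HT),
      (∀ x : A, ((ρ x : HT) : 𝓜(ℂ, HT)) = ψext (k x) * ((u : HT) : 𝓜(ℂ, HT))) →
      IsNuclearMap ρ := by
    intro k hk u ρ hρ
    have h1 := ii_iv hI hjH hrH (cM_ideal HT) ψext hψext k hk u
    have e : ρ = actL (cM HT) (cM_ideal HT) (ψext.comp k) u := by
      refine LinearMap.ext fun x => (cM_ideal HT).inj ?_
      rw [actL_spec]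
      exact hρ x
    rw [e]; exact h1
  have h_iv_iii : ((∀ (u : HT) (ρ : A →ₗ[ℂ] HT),
          (∀ x : A, ((ρ x : HT) : 𝓜(ℂ, HT)) = ψext (P.ι x) * ((u : HT) : 𝓜(ℂ, HT))) →
          IsNuclearMap ρ) ∧
       (∀ (u : HT) (ρ : A →ₗ[ℂ] HT),
          (∀ x : A, ((ρ x : HT) : 𝓜(ℂ, HT)) = ψext (P.ιbar x) * ((u : HT) : 𝓜(ℂ, HT))) →
          IsNuclearMap ρ)) →
      (∃ (E : Type) (iE : NonUnitalCStarAlgebra E) (J : Type) (iJ : NonUnitalCStarAlgebra J),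
        Nonempty (@QNuclearWitness A QA qA B _ _ _ _ P j ψ E J iE iJ)) := by
    rintro ⟨h1, h2⟩
    refine ⟨𝓜(ℂ, HT), inferInstance, HT, inferInstance, ⟨
      { ψ₁ := ψext.comp P.ι
        ψ₂ := ψext.comp P.ιbar
        jJE := cM HT
        hJE := cM_ideal HT
        jJB := jH
        hJB := hjH
        hdiff := fun x => ?_
        Θ := ψext
        hΘ := rfl
        hΘ' := rfl
        hrep := fun z => ?_
        wn₁ := fun u ρ hρ => h1 u ρ hρ
        wn₂ := fun u ρ hρ => h2 u ρ hρ }⟩⟩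
    · obtain ⟨u, hu⟩ := hrg (qe x)
      refine ⟨u, ?_⟩
      have := hψext _ _ hu
      rw [hqe, map_sub] at this
      exact this.symm
    · obtain ⟨u, hu⟩ := hrg z
      exact ⟨u, (hψext _ _ hu).symm, hu.symm⟩
  have h_iii_ii : (∃ (E : Type) (iE : NonUnitalCStarAlgebra E) (J : Type)
      (iJ : NonUnitalCStarAlgebra J),
        Nonempty (@QNuclearWitness A QA qA B _ _ _ _ P j ψ E J iE iJ)) →
      ((∀ y, y ∈ nucSub j hI P.ι ψ) ∧ (∀ y, y ∈ nucSub j hI P.ιbar ψ)) := by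
    rintro ⟨E, iE, J, iJ, ⟨W⟩⟩
    refine ⟨fun y => iii_ii W P.ι (fun u ρ hρ => W.wn₁ u ρ fun x => ?_) y,
      fun y => iii_ii W P.ιbar (fun u ρ hρ => W.wn₂ u ρ fun x => ?_) y⟩
    · rw [hρ x, ← W.hΘ]; rfl
    · rw [hρ x, ← W.hΘ']; rfl
  rw [i_ii_iff, ii_iff]
  refine ⟨⟨fun h => ⟨i_ii P hπ hπ' hj hr qe hqe ψ h, i_ii' P hπ hπ' hj hr qe hqe ψ h⟩,
    fun h => ii_i P hI qe hqe ψ h.1 h.2⟩,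
    ⟨fun h => h_iv_iii ⟨hwn _ h.1, hwn _ h.2⟩, h_iii_ii⟩,
    ⟨fun h => ⟨hwn _ (h_iii_ii h).1, hwn _ (h_iii_ii h).2⟩, h_iv_iii⟩⟩

end
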